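/- Let I₀ ⊂ ℝ be an interval, let f ∈ C³(I₀) with f''(x) ≠ 0 for almost all x ∈ I₀, and set C_f := {(x, f(x)) : x ∈ I₀}. Then C_f is of Khintchine type for divergence: for every approximating function ψ with ∑_{h=1}^∞ ψ(h)² = ∞, ℋ¹-almost every point of C_f lies in S₂(ψ), i.e. ℋ¹(C_f \ S₂(ψ)) = 0. -/

import Mathlib

open MeasureTheory Filter

/-- The distance from a real number to the nearest integer. -/
noncomputable def distNearestInt (x : ℝ) : ℝ := |x - round x|

/-- An approximating function: a decreasing function `ℝ₊ → ℝ₊` taking positive values. -/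
def IsApproxFun (ψ : ℝ → ℝ) : Prop :=
  (∀ x y : ℝ, 0 < x → x ≤ y → ψ y ≤ ψ x) ∧ ∀ x : ℝ, 0 < x → 0 < ψ x

/-- The set `S₂(ψ)` of simultaneously `ψ`-approximable points of the plane. -/
def SimApprox2 (ψ : ℝ → ℝ) : Set (ℝ × ℝ) :=
  {y : ℝ × ℝ |
    {q : ℕ | 0 < q ∧
      max (distNearestInt (q * y.1)) (distNearestInt (q * y.2)) < ψ q}.Infinite}

/-- A differentiable function on `[A, B]` with derivative `f₁`, where `f₁` is bounded by `M` and
increases at a rate between `c > 0` and `M`. -/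
structure ConvexArc (f f₁ : ℝ → ℝ) (A B c M : ℝ) : Prop where
  c_pos : 0 < c
  one_le : 1 ≤ M
  hasDerivAt : ∀ x ∈ Set.Icc A B, HasDerivAt f (f₁ x) x
  slope_lower : ∀ x ∈ Set.Icc A B, ∀ y ∈ Set.Icc A B, x ≤ y → c * (y - x) ≤ f₁ y - f₁ x
  slope_upper : ∀ x ∈ Set.Icc A B, ∀ y ∈ Set.Icc A B, x ≤ y → f₁ y - f₁ x ≤ M * (y - x)
  bound : ∀ x ∈ Set.Icc A B, |f₁ x| ≤ M

/-- The linear form `q f - s - f₁ (q x - p)`, measuring how far `(p / q, s / q)` is from the tangent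
to the graph of `f` at `x`. -/
def tangentForm (f f₁ : ℝ → ℝ) (q p s : ℤ) (x : ℝ) : ℝ :=
  q * f x - s - f₁ x * (q * x - p)

theorem taylor_bounds_of_slope_bounds {f f₁ : ℝ → ℝ} {A B k : ℝ}
    (hd : ∀ x ∈ Set.Icc A B, HasDerivAt f (f₁ x) x)
    (hl : ∀ x ∈ Set.Icc A B, ∀ y ∈ Set.Icc A B, x ≤ y → k * (y - x) ≤ f₁ y - f₁ x)
    {x y : ℝ} (hx : x ∈ Set.Icc A B) (hy : y ∈ Set.Icc A B) :
    k / 2 * (y - x) ^ 2 ≤ f y - f x - f₁ x * (y - x) := by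
  let g : ℝ → ℝ := fun t => f t - f x - f₁ x * (t - x) - k / 2 * (t - x) ^ 2
  have hg : ∀ t ∈ Set.Icc A B, HasDerivAt g (f₁ t - f₁ x - k * (t - x)) t := by
    intro t ht
    have h1 := (((hd t ht).sub_const (f x)).sub
      (((hasDerivAt_id t).sub_const x).const_mul (f₁ x))).sub
      ((((hasDerivAt_id t).sub_const x).pow 2).const_mul (k / 2))
    refine h1.congr_deriv ?_
    simp
    ring
  have hgx : g x = 0 := by simp [g]
  suffices 0 ≤ g y by simp only [g] at this; linarith
  rcases le_total x y with hxy | hxy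
  · have hsub : Set.Icc x y ⊆ Set.Icc A B := Set.Icc_subset_Icc hx.1 hy.2
    have hm : MonotoneOn g (Set.Icc x y) := by
      apply monotoneOn_of_deriv_nonneg (convex_Icc x y)
      · exact fun t ht => (hg t (hsub ht)).continuousAt.continuousWithinAt
      · exact fun t ht =>
          (hg t (hsub (interior_subset ht))).differentiableAt.differentiableWithinAt
      · intro t ht
        have ht' := interior_subset ht
        rw [(hg t (hsub ht')).deriv]
        linarith [hl x hx t (hsub ht') ht'.1]
    have := hm (Set.left_mem_Icc.2 hxy) (Set.right_mem_Icc.2 hxy) hxy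
    linarith
  · have hsub : Set.Icc y x ⊆ Set.Icc A B := Set.Icc_subset_Icc hy.1 hx.2
    have hm : AntitoneOn g (Set.Icc y x) := by
      apply antitoneOn_of_deriv_nonpos (convex_Icc y x)
      · exact fun t ht => (hg t (hsub ht)).continuousAt.continuousWithinAt
      · exact fun t ht =>
          (hg t (hsub (interior_subset ht))).differentiableAt.differentiableWithinAt
      · intro t ht
        have ht' := interior_subset ht
        rw [(hg t (hsub ht')).deriv]
        have := hl t (hsub ht') x hx ht'.2
        linarith
    have := hm (Set.left_mem_Icc.2 hxy) (Set.right_mem_Icc.2 hxy) hxy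
    linarith

namespace ConvexArc

variable {f f₁ : ℝ → ℝ} {A B c M : ℝ}

theorem taylor_lower (hf : ConvexArc f f₁ A B c M) {x y : ℝ} (hx : x ∈ Set.Icc A B)
    (hy : y ∈ Set.Icc A B) : c / 2 * (y - x) ^ 2 ≤ f y - f x - f₁ x * (y - x) :=
  taylor_bounds_of_slope_bounds hf.hasDerivAt hf.slope_lower hx hy

theorem taylor_upper (hf : ConvexArc f f₁ A B c M) {x y : ℝ} (hx : x ∈ Set.Icc A B)
    (hy : y ∈ Set.Icc A B) : f y - f x - f₁ x * (y - x) ≤ M / 2 * (y - x) ^ 2 := by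
  have := taylor_bounds_of_slope_bounds (f := fun x => -f x) (f₁ := fun x => -f₁ x) (k := -M)
    (fun x hx => (hf.hasDerivAt x hx).neg)
    (fun x hx y hy hxy => by linarith [hf.slope_upper x hx y hy hxy]) hx hy
  linarith

theorem abs_taylor (hf : ConvexArc f f₁ A B c M) {x y : ℝ} (hx : x ∈ Set.Icc A B)
    (hy : y ∈ Set.Icc A B) : |f y - f x - f₁ x * (y - x)| ≤ M / 2 * (y - x) ^ 2 := by
  have h1 := hf.taylor_lower hx hy
  have h2 := hf.taylor_upper hx hy
  have : 0 ≤ c / 2 * (y - x) ^ 2 := by have := hf.c_pos; positivity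
  rw [abs_of_nonneg (by linarith)]
  exact h2

theorem abs_slope (hf : ConvexArc f f₁ A B c M) {x y : ℝ} (hx : x ∈ Set.Icc A B)
    (hy : y ∈ Set.Icc A B) : |f₁ y - f₁ x| ≤ M * |y - x| := by
  have hc := hf.c_pos
  rcases le_total x y with hxy | hxy
  · have h1 := hf.slope_lower x hx y hy hxy
    have h2 := hf.slope_upper x hx y hy hxy
    have : 0 ≤ c * (y - x) := mul_nonneg hc.le (by linarith)
    rw [abs_of_nonneg (by linarith), abs_of_nonneg (by linarith)]
    exact h2
  · have h1 := hf.slope_lower y hy x hx hxy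
    have h2 := hf.slope_upper y hy x hx hxy
    have : 0 ≤ c * (x - y) := mul_nonneg hc.le (by linarith)
    rw [abs_sub_comm, abs_sub_comm y x, abs_of_nonneg (by linarith), abs_of_nonneg (by linarith)]
    exact h2

theorem strictMonoOn (hf : ConvexArc f f₁ A B c M) : StrictMonoOn f₁ (Set.Icc A B) := by
  intro x hx y hy hxy
  have := hf.slope_lower x hx y hy hxy.le
  have : 0 < c * (y - x) := mul_pos hf.c_pos (by linarith)
  linarith

theorem abs_tangentForm_sub_le (hf : ConvexArc f f₁ A B c M) {x y : ℝ} (hx : x ∈ Set.Icc A B)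
    (hy : y ∈ Set.Icc A B) (q p s : ℤ) :
    |tangentForm f f₁ q p s y - tangentForm f f₁ q p s x| ≤
      |(q : ℝ)| * (M / 2 * (y - x) ^ 2) + M * |y - x| * |q * y - p| := by
  have h : tangentForm f f₁ q p s y - tangentForm f f₁ q p s x =
      q * (f y - f x - f₁ x * (y - x)) - (f₁ y - f₁ x) * (q * y - p) := by
    unfold tangentForm; ring
  rw [h]
  refine (abs_sub _ _).trans ?_
  rw [abs_mul, abs_mul]
  gcongr
  · exact hf.abs_taylor hx hy
  · exact hf.abs_slope hx hy

theorem abs_comb_le (hf : ConvexArc f f₁ A B c M) {x y : ℝ} (hx : x ∈ Set.Icc A B)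
    (hy : y ∈ Set.Icc A B) (a₀ a₁ a₂ : ℝ) :
    |a₀ + a₁ * y + a₂ * f y| ≤
      |a₀ + a₁ * x + a₂ * f x| + |a₁ + a₂ * f₁ x| * |y - x| + |a₂| * (M / 2 * (y - x) ^ 2) := by
  have h : a₀ + a₁ * y + a₂ * f y = (a₀ + a₁ * x + a₂ * f x) + (a₁ + a₂ * f₁ x) * (y - x) +
      a₂ * (f y - f x - f₁ x * (y - x)) := by ring
  rw [h]
  refine (abs_add_three _ _ _).trans ?_
  rw [abs_mul, abs_mul]
  gcongr
  exact hf.abs_taylor hx hy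

theorem abs_deriv_comb_le (hf : ConvexArc f f₁ A B c M) {x y : ℝ} (hx : x ∈ Set.Icc A B)
    (hy : y ∈ Set.Icc A B) (a₁ a₂ : ℝ) :
    |(a₁ + a₂ * f₁ y) - (a₁ + a₂ * f₁ x)| ≤ |a₂| * (M * |y - x|) := by
  have h : (a₁ + a₂ * f₁ y) - (a₁ + a₂ * f₁ x) = a₂ * (f₁ y - f₁ x) := by ring
  rw [h, abs_mul]
  gcongr
  exact hf.abs_slope hx hy

end ConvexArc

/-- A covering bound: a set that fills only a small proportion `θ` of the fivefold enlargement of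
a suitable ball around each of its points is small. -/
theorem volume_le_of_local_density {a b r₀ θ : ℝ} (hθ : 0 ≤ θ) {E : Set ℝ}
    (hE : E ⊆ Set.Icc a b) {r : ℝ → ℝ} (hr : ∀ x ∈ E, 0 < r x) (hr₀ : ∀ x ∈ E, r x ≤ r₀)
    (h : ∀ x ∈ E, volume (E ∩ Metric.closedBall x (5 * r x)) ≤ ENNReal.ofReal (θ * (2 * r x))) :
    volume E ≤ ENNReal.ofReal (θ * (b - a + 2 * r₀)) := by
  obtain ⟨u, huE, hdisj, hcov⟩ :=
    Vitali.exists_disjoint_subfamily_covering_enlargement_closedBall E (fun x => x) r r₀ hr₀ 5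
      (by norm_num)
  have hcount : u.Countable := by
    apply hdisj.countable_of_nonempty_interior
    intro x hx
    rw [interior_closedBall _ (hr x (huE hx)).ne']
    exact Metric.nonempty_ball.2 (hr x (huE hx))
  have hsub : E ⊆ ⋃ x ∈ u, (E ∩ Metric.closedBall x (5 * r x)) := by
    intro x hx
    obtain ⟨y, hy, hxy⟩ := hcov x hx
    exact Set.mem_biUnion hy ⟨hx, hxy (Metric.mem_closedBall_self (hr x hx).le)⟩
  have hball : ∀ x : ℝ, volume (Metric.closedBall x (r x)) = ENNReal.ofReal (2 * r x) :=
    fun x => Real.volume_closedBall _ _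
  calc volume E ≤ volume (⋃ x ∈ u, (E ∩ Metric.closedBall x (5 * r x))) := measure_mono hsub
    _ ≤ ∑' x : u, volume (E ∩ Metric.closedBall (x : ℝ) (5 * r x)) :=
        measure_biUnion_le _ hcount _
    _ ≤ ∑' x : u, ENNReal.ofReal θ * volume (Metric.closedBall (x : ℝ) (r x)) := by
        gcongr with x
        rw [hball, ← ENNReal.ofReal_mul hθ]
        exact h x (huE x.2)
    _ = ENNReal.ofReal θ * volume (⋃ x ∈ u, Metric.closedBall (x : ℝ) (r x)) := by
        rw [ENNReal.tsum_mul_left, measure_biUnion hcount hdisj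
          (fun x _ => Metric.isClosed_closedBall.measurableSet)]
    _ ≤ ENNReal.ofReal θ * volume (Set.Icc (a - r₀) (b + r₀)) := by
        gcongr
        refine Set.iUnion₂_subset fun x hx y hy => ?_
        rw [Real.closedBall_eq_Icc] at hy
        have h1 := hE (huE hx)
        have h2 := hr₀ x (huE hx)
        exact ⟨by linarith [hy.1, h1.1], by linarith [hy.2, h1.2]⟩
    _ = ENNReal.ofReal (θ * (b - a + 2 * r₀)) := by
        rw [Real.volume_Icc, ← ENNReal.ofReal_mul hθ]
        congr 2; ring

theorem volume_le_of_forall_abs_sub_le {S : Set ℝ} {d : ℝ}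
    (h : ∀ x ∈ S, ∀ y ∈ S, x ≤ y → y - x ≤ d) : volume S ≤ ENNReal.ofReal d := by
  refine (Real.volume_le_diam S).trans ?_
  refine Metric.ediam_le fun x hx y hy => ?_
  rw [edist_dist]
  apply ENNReal.ofReal_le_ofReal
  rw [Real.dist_eq]
  rcases le_total x y with hxy | hxy
  · rw [abs_sub_comm, abs_of_nonneg (by linarith)]; exact h x hx y hy hxy
  · rw [abs_of_nonneg (by linarith)]; exact h y hy x hx hxy

namespace ConvexArc

variable {f f₁ : ℝ → ℝ} {A B c M : ℝ}

theorem hasDerivAt_comb (hf : ConvexArc f f₁ A B c M) (a₀ a₁ a₂ : ℝ) {x : ℝ}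
    (hx : x ∈ Set.Icc A B) :
    HasDerivAt (fun x => a₀ + a₁ * x + a₂ * f x) (a₁ + a₂ * f₁ x) x := by
  have := (((hasDerivAt_id x).const_mul a₁).const_add a₀).add ((hf.hasDerivAt x hx).const_mul a₂)
  refine this.congr_deriv ?_
  ring

/-- Sublevel sets of `a₀ + a₁ x + a₂ f x` for positive `a₂`. -/
theorem volume_sublevel_le_of_pos (hf : ConvexArc f f₁ A B c M) {a₀ a₁ a₂ η : ℝ} (ha : 0 < a₂)
    (hη : 0 < η) :
    volume {x | x ∈ Set.Icc A B ∧ |a₀ + a₁ * x + a₂ * f x| ≤ η} ≤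
      ENNReal.ofReal (6 * √(η / (c * a₂))) := by
  set k := c * a₂ with hk
  have hc := hf.c_pos
  have hk0 : 0 < k := mul_pos hc ha
  set τ := √(η / k) with hτ
  have hτ0 : 0 < τ := Real.sqrt_pos.2 (by positivity)
  have hτ2 : k * τ ^ 2 = η := by
    rw [hτ, Real.sq_sqrt (by positivity)]; field_simp
  have htan : ∀ x ∈ Set.Icc A B, ∀ y ∈ Set.Icc A B,
      (a₁ + a₂ * f₁ x) * (y - x) ≤
        (a₀ + a₁ * y + a₂ * f y) - (a₀ + a₁ * x + a₂ * f x) := by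
    intro x hx y hy
    have h1 := hf.taylor_lower hx hy
    have h2 : 0 ≤ c / 2 * (y - x) ^ 2 := by positivity
    have h3 : 0 ≤ a₂ * (f y - f x - f₁ x * (y - x)) := mul_nonneg ha.le (by linarith)
    nlinarith
  have hsub : {x | x ∈ Set.Icc A B ∧ |a₀ + a₁ * x + a₂ * f x| ≤ η} ⊆
      ({x | x ∈ Set.Icc A B ∧ |a₀ + a₁ * x + a₂ * f x| ≤ η ∧ k * τ ≤ a₁ + a₂ * f₁ x} ∪
      {x | x ∈ Set.Icc A B ∧ |a₀ + a₁ * x + a₂ * f x| ≤ η ∧ a₁ + a₂ * f₁ x ≤ -(k * τ)}) ∪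
      {x | x ∈ Set.Icc A B ∧ |a₁ + a₂ * f₁ x| ≤ k * τ} := by
    rintro x ⟨hx, hx'⟩
    rcases le_total (k * τ) (a₁ + a₂ * f₁ x) with h | h
    · exact Or.inl (Or.inl ⟨hx, hx', h⟩)
    rcases le_total (a₁ + a₂ * f₁ x) (-(k * τ)) with h' | h'
    · exact Or.inl (Or.inr ⟨hx, hx', h'⟩)
    · exact Or.inr ⟨hx, abs_le.2 ⟨h', h⟩⟩
  have hkτ : 0 < k * τ := by positivity
  have e1 : volume {x | x ∈ Set.Icc A B ∧ |a₀ + a₁ * x + a₂ * f x| ≤ η ∧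
      k * τ ≤ a₁ + a₂ * f₁ x} ≤ ENNReal.ofReal (2 * τ) := by
    apply volume_le_of_forall_abs_sub_le
    rintro x ⟨hx, hx1, hx2⟩ y ⟨hy, hy1, hy2⟩ hxy
    have h1 := htan x hx y hy
    have h2 : k * τ * (y - x) ≤ (a₁ + a₂ * f₁ x) * (y - x) :=
      mul_le_mul_of_nonneg_right hx2 (by linarith)
    rw [abs_le] at hx1 hy1
    have : k * τ * (y - x) ≤ k * τ * (2 * τ) := by nlinarith
    exact le_of_mul_le_mul_left this hkτ
  have e2 : volume {x | x ∈ Set.Icc A B ∧ |a₀ + a₁ * x + a₂ * f x| ≤ η ∧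
      a₁ + a₂ * f₁ x ≤ -(k * τ)} ≤ ENNReal.ofReal (2 * τ) := by
    apply volume_le_of_forall_abs_sub_le
    rintro x ⟨hx, hx1, hx2⟩ y ⟨hy, hy1, hy2⟩ hxy
    have h1 := htan y hy x hx
    have h2 : k * τ * (y - x) ≤ (a₁ + a₂ * f₁ y) * (x - y) := by nlinarith
    rw [abs_le] at hx1 hy1
    have : k * τ * (y - x) ≤ k * τ * (2 * τ) := by nlinarith
    exact le_of_mul_le_mul_left this hkτ
  have e3 : volume {x | x ∈ Set.Icc A B ∧ |a₁ + a₂ * f₁ x| ≤ k * τ} ≤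
      ENNReal.ofReal (2 * τ) := by
    apply volume_le_of_forall_abs_sub_le
    rintro x ⟨hx, hx1⟩ y ⟨hy, hy1⟩ hxy
    have h1 := hf.slope_lower x hx y hy hxy
    rw [abs_le] at hx1 hy1
    have h2 : a₂ * (c * (y - x)) ≤ a₂ * (f₁ y - f₁ x) := mul_le_mul_of_nonneg_left h1 ha.le
    have : k * (y - x) ≤ k * (2 * τ) := by rw [hk] at *; nlinarith
    exact le_of_mul_le_mul_left this hk0
  calc _ ≤ _ := measure_mono hsub
    _ ≤ (ENNReal.ofReal (2 * τ) + ENNReal.ofReal (2 * τ)) + ENNReal.ofReal (2 * τ) :=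
      (measure_union_le _ _).trans (add_le_add ((measure_union_le _ _).trans (add_le_add e1 e2)) e3)
    _ = ENNReal.ofReal (6 * τ) := by
      rw [← ENNReal.ofReal_add (by positivity) (by positivity),
        ← ENNReal.ofReal_add (by positivity) (by positivity)]
      congr 1; ring

theorem volume_sublevel_le (hf : ConvexArc f f₁ A B c M) {a₀ a₁ a₂ η : ℝ} (ha : a₂ ≠ 0)
    (hη : 0 < η) :
    volume {x | x ∈ Set.Icc A B ∧ |a₀ + a₁ * x + a₂ * f x| ≤ η} ≤
      ENNReal.ofReal (6 * √(η / (c * |a₂|))) := by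
  rcases lt_or_gt_of_ne ha with h | h
  · have := hf.volume_sublevel_le_of_pos (a₀ := -a₀) (a₁ := -a₁) (neg_pos.2 h) hη
    rw [abs_of_neg h]
    convert this using 6 with x
    rw [← abs_neg]; congr 1; ring
  · rw [abs_of_pos h]
    exact hf.volume_sublevel_le_of_pos h hη

theorem volume_sublevel_le_of_le_deriv (hf : ConvexArc f f₁ A B c M) {a₀ a₁ a₂ η K u v : ℝ}
    (huv : Set.Icc u v ⊆ Set.Icc A B) (hK : 0 < K)
    (hd : ∀ x ∈ Set.Icc u v, K ≤ |a₁ + a₂ * f₁ x|) :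
    volume {x | x ∈ Set.Icc u v ∧ |a₀ + a₁ * x + a₂ * f x| ≤ η} ≤
      ENNReal.ofReal (2 * η / K) := by
  apply volume_le_of_forall_abs_sub_le
  rintro x ⟨hx, hx1⟩ y ⟨hy, hy1⟩ hxy
  rcases hxy.eq_or_lt with rfl | hlt
  · have : 0 ≤ η := (abs_nonneg _).trans hx1
    simpa using by positivity
  have hsub : Set.Icc x y ⊆ Set.Icc u v := Set.Icc_subset_Icc hx.1 hy.2
  obtain ⟨z, hz, hz'⟩ := exists_hasDerivAt_eq_slope (fun x => a₀ + a₁ * x + a₂ * f x)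
    (fun x => a₁ + a₂ * f₁ x) hlt
    (fun t ht => (hf.hasDerivAt_comb a₀ a₁ a₂ (huv (hsub ht))).continuousAt.continuousWithinAt)
    (fun t ht => hf.hasDerivAt_comb a₀ a₁ a₂ (huv (hsub (Set.Ioo_subset_Icc_self ht))))
  have h1 := hd z (hsub (Set.Ioo_subset_Icc_self hz))
  rw [hz', abs_div, abs_of_pos (sub_pos.2 hlt), le_div_iff₀ (sub_pos.2 hlt)] at h1
  rw [le_div_iff₀ hK]
  have h2 := abs_sub (a₀ + a₁ * y + a₂ * f y) (a₀ + a₁ * x + a₂ * f x)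
  linarith

/-- Around a point where `a₀ + a₁ x + a₂ f x` is small there is a scale at which it is
typically much larger, while it and its derivative are still controlled. -/
theorem exists_good_radius (hf : ConvexArc f f₁ A B c M) {g η : ℝ} (hg : 1 ≤ g) (hη : 0 < η)
    (hgη : g ^ 2 * η ≤ 1) {a₀ a₁ a₂ : ℤ} (ha : a₁ ≠ 0 ∨ a₂ ≠ 0) {x : ℝ}
    (hx : Set.Icc (x - 5 * (g * √η)) (x + 5 * (g * √η)) ⊆ Set.Icc A B) :
    ∃ r, 0 < r ∧ r ≤ g * √η ∧ |(a₂ : ℝ)| * r ^ 2 ≤ g ^ 2 * η ∧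
      |a₁ + a₂ * f₁ x| * r ≤ g ^ 2 * η ∧
      volume {y | y ∈ Set.Icc (x - 5 * r) (x + 5 * r) ∧ |a₀ + a₁ * y + a₂ * f y| ≤ η} ≤
        ENNReal.ofReal ((60 * M / √c + 8) / g * r) := by
  have hc := hf.c_pos
  have hM := hf.one_le
  set K := |a₁ + a₂ * f₁ x| with hK
  set k := |(a₂ : ℝ)| with hk
  have hK0 : 0 ≤ K := abs_nonneg _
  have hk0 : 0 ≤ k := abs_nonneg _
  have hg0 : 0 < g := by linarith
  have hη' := Real.sq_sqrt hη.le
  have hη0 := Real.sqrt_pos.2 hη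
  have hxAB : x ∈ Set.Icc A B := hx ⟨by nlinarith, by nlinarith⟩
  have hk1 : a₂ ≠ 0 → 1 ≤ k := fun h => by
    rw [hk]; exact_mod_cast Int.one_le_abs h
  have hsubr : ∀ r, r ≤ g * √η → Set.Icc (x - 5 * r) (x + 5 * r) ⊆ Set.Icc A B := fun r hr =>
    (Set.Icc_subset_Icc (by linarith) (by linarith)).trans hx
  by_cases hcase : 100 * M ^ 2 * k * (g ^ 2 * η) ≤ K ^ 2 ∧ 0 < K
  · obtain ⟨h1, hKpos⟩ := hcase
    set r := g ^ 2 * η / K with hr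
    have hr0 : 0 < r := by positivity
    have hrK : K * r = g ^ 2 * η := by rw [hr]; field_simp
    have hkr : 100 * M ^ 2 * k * r ≤ K := by
      have : K * (100 * M ^ 2 * k * r) ≤ K * K := by
        rw [show K * (100 * M ^ 2 * k * r) = 100 * M ^ 2 * k * (K * r) by ring, hrK]
        linarith [sq K]
      exact le_of_mul_le_mul_left this hKpos
    have hkr2 : k * r ^ 2 ≤ g ^ 2 * η := by
      have h3 : k * r ≤ K := by
        have : 0 ≤ k * r := by positivity
        nlinarith [mul_nonneg this (by nlinarith : 0 ≤ 100 * M ^ 2 - 1)]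
      calc k * r ^ 2 = (k * r) * r := by ring
        _ ≤ K * r := by gcongr
        _ = _ := hrK
    have hrle : r ≤ g * √η := by
      apply le_of_sq_le_sq _ (by positivity)
      rw [mul_pow, hη']
      by_cases h : a₂ = 0
      · have hK1 : 1 ≤ K := by
          have : a₁ ≠ 0 := by tauto
          rw [hK, h]; simp only [Int.cast_zero, zero_mul, add_zero]
          exact_mod_cast Int.one_le_abs this
        have : r ≤ g ^ 2 * η := by nlinarith
        have h5 : 0 < g ^ 2 * η := by positivity
        nlinarith
      · have := hk1 h
        nlinarith [sq_nonneg r]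
    refine ⟨r, hr0, hrle, hkr2, hrK.le, ?_⟩
    refine (hf.volume_sublevel_le_of_le_deriv (K := K / 2) (hsubr r hrle) (by positivity)
      ?_).trans (ENNReal.ofReal_le_ofReal ?_)
    · intro y hy
      have h3 := hf.abs_deriv_comb_le hxAB (hsubr r hrle hy) a₁ a₂
      have h4 : |y - x| ≤ 5 * r := abs_le.2 ⟨by linarith [hy.1], by linarith [hy.2]⟩
      have h5 : k * (M * |y - x|) ≤ k * (M * (5 * r)) := by gcongr
      have h6 : k * (M * (5 * r)) ≤ K / 2 := by
        have : 0 ≤ k * r := by positivity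
        nlinarith [mul_nonneg this (by nlinarith : 0 ≤ M ^ 2 - M)]
      have h7 := abs_sub_abs_le_abs_sub (a₁ + a₂ * f₁ x) (a₁ + a₂ * f₁ y)
      rw [abs_sub_comm (a₁ + a₂ * f₁ x)] at h7
      linarith
    · have h8 : 2 * η / (K / 2) = 4 / g ^ 2 * r := by rw [hr]; field_simp; ring
      rw [h8]
      have h9 : (4 : ℝ) / g ^ 2 ≤ (60 * M / √c + 8) / g := by
        rw [div_le_div_iff₀ (by positivity) hg0]
        have : 0 ≤ 60 * M / √c := by positivity
        nlinarith
      gcongr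
  · have h1 : K ^ 2 ≤ 100 * M ^ 2 * k * (g ^ 2 * η) := by
      by_contra! h
      refine hcase ⟨h.le, ?_⟩
      rcases hK0.eq_or_lt with h0 | h0
      · rw [← h0] at h
        have : 0 ≤ 100 * M ^ 2 * k * (g ^ 2 * η) := by positivity
        linarith
      · exact h0
    have ha2 : a₂ ≠ 0 := by
      intro h
      have : a₁ ≠ 0 := by tauto
      have hK1 : 1 ≤ K := by
        rw [hK, h]; simp only [Int.cast_zero, zero_mul, add_zero]
        exact_mod_cast Int.one_le_abs this
      have : k = 0 := by rw [hk, h]; simp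
      rw [this] at h1
      nlinarith
    have hk1 := hk1 ha2
    have hkpos : 0 < k := by linarith
    set r := g * √(η / k) / (10 * M) with hr
    have hr0 : 0 < r := by positivity
    have hr2 : 100 * M ^ 2 * (k * r ^ 2) = g ^ 2 * η := by
      rw [hr, div_pow, mul_pow, Real.sq_sqrt (by positivity)]; field_simp; ring
    have hkr2 : k * r ^ 2 ≤ g ^ 2 * η := by
      have : 0 ≤ k * r ^ 2 := by positivity
      nlinarith [mul_nonneg this (by nlinarith : 0 ≤ M ^ 2 - 1)]
    have hrle : r ≤ g * √η := by
      apply le_of_sq_le_sq _ (by positivity)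
      rw [mul_pow, hη']
      nlinarith [sq_nonneg r]
    refine ⟨r, hr0, hrle, hkr2, ?_, ?_⟩
    · apply le_of_sq_le_sq _ (by positivity)
      calc (K * r) ^ 2 = K ^ 2 * r ^ 2 := by ring
        _ ≤ (100 * M ^ 2 * k * (g ^ 2 * η)) * r ^ 2 := by gcongr
        _ = (100 * M ^ 2 * (k * r ^ 2)) * (g ^ 2 * η) := by ring
        _ = _ := by rw [hr2]; ring
    · refine (measure_mono ?_).trans ((hf.volume_sublevel_le (a₀ := a₀) (a₁ := a₁)
        (a₂ := a₂) (by exact_mod_cast ha2) hη).trans (ENNReal.ofReal_le_ofReal ?_))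
      · rintro y ⟨hy, hy'⟩
        exact ⟨hsubr r hrle hy, hy'⟩
      · have : √(η / (c * k)) = √(η / k) / √c := by
          rw [← Real.sqrt_div' _ hc.le]; congr 1; field_simp
        rw [← hk, this]
        have h3 : 6 * (√(η / k) / √c) = 60 * M / √c / g * r := by
          rw [hr]; field_simp; ring
        rw [h3]
        have : 60 * M / √c ≤ 60 * M / √c + 8 := by linarith
        gcongr

end ConvexArc

/-- A convex function with derivative at least `K` on an interval `I` spends little time close to
integers. -/
theorem volume_near_int_le_of_monotone {I : Set ℝ} (hI : I.OrdConnected) {g g' : ℝ → ℝ} {K η : ℝ}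
    (hg : ∀ x ∈ I, HasDerivAt g (g' x) x) (hmono : MonotoneOn g' I) (hK : 0 < K)
    (hgK : ∀ x ∈ I, K ≤ g' x) (hη0 : 0 ≤ η) (hη : η ≤ 1 / 4) :
    volume {x | x ∈ I ∧ ∃ n : ℤ, |g x - n| ≤ η} ≤
      ENNReal.ofReal (2 * η / K) + ENNReal.ofReal (8 * η) * volume I := by
  have hsub : ∀ {x y}, x ∈ I → y ∈ I → Set.Icc x y ⊆ I := fun hx hy => hI.out hx hy
  have hslope : ∀ x ∈ I, ∀ y ∈ I, x < y → ∃ z ∈ Set.Ioo x y, g y - g x = g' z * (y - x) := by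
    intro x hx y hy hxy
    obtain ⟨z, hz, hz'⟩ := exists_hasDerivAt_eq_slope g g' hxy
      (fun t ht => (hg t (hsub hx hy ht)).continuousAt.continuousWithinAt)
      (fun t ht => hg t (hsub hx hy (Set.Ioo_subset_Icc_self ht)))
    refine ⟨z, hz, ?_⟩
    rw [hz', div_mul_cancel₀ _ (sub_pos.2 hxy).ne']
  have hstrict : StrictMonoOn g I := by
    intro x hx y hy hxy
    obtain ⟨z, hz, hz'⟩ := hslope x hx y hy hxy
    have := hgK z (hsub hx hy (Set.Ioo_subset_Icc_self hz))
    have : 0 < g' z * (y - x) := mul_pos (by linarith) (sub_pos.2 hxy)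
    linarith
  have hlow : ∀ u ∈ I, ∀ x ∈ I, ∀ y ∈ I, u ≤ x → x ≤ y → g' u * (y - x) ≤ g y - g x := by
    intro u hu x hx y hy hux hxy
    rcases hxy.eq_or_lt with rfl | hlt
    · simp
    obtain ⟨z, hz, hz'⟩ := hslope x hx y hy hlt
    rw [hz']
    have := hmono hu (hsub hx hy (Set.Ioo_subset_Icc_self hz)) (hux.trans hz.1.le)
    gcongr
  let S : ℤ → Set ℝ := fun n => {x | x ∈ I ∧ |g x - n| ≤ η ∧ ∃ y ∈ I, g y ≤ n - 1 / 2}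
  let T : ℤ → Set ℝ := fun n => {x | x ∈ I ∧ (n : ℝ) - 1 / 2 ≤ g x ∧ g x < n}
  let Ex : Set ℝ := {x | x ∈ I ∧ ∃ n : ℤ, |g x - n| ≤ η ∧ ∀ y ∈ I, (n : ℝ) - 1 / 2 < g y}
  have hcover : {x | x ∈ I ∧ ∃ n : ℤ, |g x - n| ≤ η} ⊆ Ex ∪ ⋃ n, S n := by
    rintro x ⟨hx, n, hn⟩
    by_cases h : ∃ y ∈ I, g y ≤ n - 1 / 2
    · exact Or.inr (Set.mem_iUnion.2 ⟨n, hx, hn, h⟩)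
    · push Not at h
      exact Or.inl ⟨hx, n, hn, h⟩
  have hEx : volume Ex ≤ ENNReal.ofReal (2 * η / K) := by
    apply volume_le_of_forall_abs_sub_le
    rintro x ⟨hx, n, hn, hn'⟩ y ⟨hy, m, hm, hm'⟩ hxy
    have hnm : n = m := by
      rw [abs_le] at hn hm
      have h1 := hn' y hy
      have h2 := hm' x hx
      have h3 : (n : ℝ) < m + 1 := by linarith
      have h4 : (m : ℝ) < n + 1 := by linarith
      norm_cast at h3 h4
      omega
    subst hnm
    rw [abs_le] at hn hm
    have h1 := hlow x hx x hx y hy le_rfl hxy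
    have h2 := hgK x hx
    rw [le_div_iff₀ hK]
    nlinarith [sub_nonneg.2 hxy]
  have hST : ∀ n, volume (S n) ≤ ENNReal.ofReal (8 * η) * volume (T n) := by
    intro n
    rcases (S n).eq_empty_or_nonempty with he | ⟨z, hz, hzn, y, hy, hyn⟩
    · rw [he]; simp
    rw [abs_le] at hzn
    have hyz : y ≤ z := by
      by_contra! h
      have := hstrict hz hy h
      linarith
    have hcont : ContinuousOn g (Set.Icc y z) := fun t ht =>
      (hg t (hsub hy hz ht)).continuousAt.continuousWithinAt
    obtain ⟨t, ht, htn⟩ := intermediate_value_Icc hyz hcont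
      (show (n : ℝ) - 1 / 2 ∈ Set.Icc (g y) (g z) from ⟨hyn, by linarith⟩)
    obtain ⟨u, hu, hun⟩ := intermediate_value_Icc hyz hcont
      (show (n : ℝ) - η ∈ Set.Icc (g y) (g z) from ⟨by linarith, by linarith⟩)
    have htI := hsub hy hz ht
    have huI := hsub hy hz hu
    have htu : t < u := by
      rw [← hstrict.lt_iff_lt htI huI, htn, hun]; linarith
    have hgu : 0 < g' u := hK.trans_le (hgK u huI)
    have h1 : volume (S n) ≤ ENNReal.ofReal (2 * η / g' u) := by
      apply volume_le_of_forall_abs_sub_le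
      rintro v ⟨hv, hvn, -⟩ w ⟨hw, hwn, -⟩ hvw
      rw [abs_le] at hvn hwn
      have huv : u ≤ v := by
        rw [← hstrict.le_iff_le huI hv, hun]; linarith
      have := hlow u huI v hv w hw huv hvw
      rw [le_div_iff₀ hgu]
      linarith
    have h2 : 1 / 4 ≤ g' u * (u - t) := by
      obtain ⟨ξ, hξ, hξ'⟩ := hslope t htI u huI htu
      have h3 := hmono (hsub htI huI (Set.Ioo_subset_Icc_self hξ)) huI hξ.2.le
      have h4 : g' ξ * (u - t) ≤ g' u * (u - t) := by
        have := sub_pos.2 htu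
        gcongr
      linarith
    have h3 : Set.Ico t u ⊆ T n := by
      intro v hv
      have hvI := hsub htI huI (Set.Ico_subset_Icc_self hv)
      refine ⟨hvI, ?_, ?_⟩
      · rw [← htn]; exact (hstrict.le_iff_le htI hvI).2 hv.1
      · have := hstrict hvI huI hv.2
        linarith
    calc volume (S n) ≤ ENNReal.ofReal (2 * η / g' u) := h1
      _ ≤ ENNReal.ofReal (8 * η * (u - t)) := by
        apply ENNReal.ofReal_le_ofReal
        rw [div_le_iff₀ hgu]
        nlinarith
      _ = ENNReal.ofReal (8 * η) * volume (Set.Ico t u) := by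
        rw [Real.volume_Ico, ENNReal.ofReal_mul (by linarith)]
      _ ≤ ENNReal.ofReal (8 * η) * volume (T n) := by gcongr
  have hTmeas : ∀ n, MeasurableSet (T n) := by
    intro n
    apply Set.OrdConnected.measurableSet
    refine ⟨fun x hx y hy z hz => ?_⟩
    have hzI := hsub hx.1 hy.1 hz
    exact ⟨hzI, hx.2.1.trans ((hstrict.le_iff_le hx.1 hzI).2 hz.1),
      ((hstrict.le_iff_le hzI hy.1).2 hz.2).trans_lt hy.2.2⟩
  have hTdisj : Pairwise (Function.onFun Disjoint T) := by
    intro n m hnm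
    rw [Function.onFun, Set.disjoint_left]
    rintro x ⟨-, h1, h2⟩ ⟨-, h3, h4⟩
    apply hnm
    have h5 : (n : ℝ) < m + 1 := by linarith
    have h6 : (m : ℝ) < n + 1 := by linarith
    norm_cast at h5 h6
    omega
  calc volume {x | x ∈ I ∧ ∃ n : ℤ, |g x - n| ≤ η} ≤ volume (Ex ∪ ⋃ n, S n) := measure_mono hcover
    _ ≤ volume Ex + ∑' n, volume (S n) :=
      (measure_union_le _ _).trans (by gcongr; exact measure_iUnion_le _)
    _ ≤ ENNReal.ofReal (2 * η / K) + ∑' n, ENNReal.ofReal (8 * η) * volume (T n) := by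
      gcongr with n; exact hST n
    _ = ENNReal.ofReal (2 * η / K) + ENNReal.ofReal (8 * η) * volume (⋃ n, T n) := by
      rw [ENNReal.tsum_mul_left, measure_iUnion hTdisj hTmeas]
    _ ≤ _ := by
      gcongr
      exact Set.iUnion_subset fun n x hx => hx.1

theorem volume_near_int_le_of_antitone {I : Set ℝ} (hI : I.OrdConnected) {g g' : ℝ → ℝ} {K η : ℝ}
    (hg : ∀ x ∈ I, HasDerivAt g (g' x) x) (hanti : AntitoneOn g' I) (hK : 0 < K)
    (hgK : ∀ x ∈ I, K ≤ g' x) (hη0 : 0 ≤ η) (hη : η ≤ 1 / 4) :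
    volume {x | x ∈ I ∧ ∃ n : ℤ, |g x - n| ≤ η} ≤
      ENNReal.ofReal (2 * η / K) + ENNReal.ofReal (8 * η) * volume I := by
  have hI' : (Neg.neg ⁻¹' I).OrdConnected :=
    ⟨fun x hx y hy z hz => hI.out hy hx ⟨neg_le_neg hz.2, neg_le_neg hz.1⟩⟩
  have h := volume_near_int_le_of_monotone (I := Neg.neg ⁻¹' I) hI' (g := fun x => -g (-x))
    (g' := fun x => g' (-x)) (K := K) (η := η)
    (fun x hx => by
      have := ((hg (-x) hx).comp x (hasDerivAt_neg x)).neg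
      refine this.congr_deriv (by ring))
    (fun x hx y hy hxy => hanti hy hx (neg_le_neg hxy)) hK (fun x hx => hgK _ hx) hη0 hη
  rw [Measure.measure_preimage_neg] at h
  refine le_trans (le_of_eq ?_) h
  rw [← Measure.measure_preimage_neg]
  congr 1
  ext x
  simp only [Set.mem_preimage, Set.mem_ofPred_eq]
  refine and_congr_right fun _ => ⟨?_, ?_⟩
  · rintro ⟨n, hn⟩
    refine ⟨-n, ?_⟩
    rw [← abs_neg]; push_cast; convert hn using 2; ring
  · rintro ⟨n, hn⟩
    refine ⟨-n, ?_⟩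
    rw [← abs_neg]; push_cast; convert hn using 2; ring

namespace ConvexArc

variable {f f₁ : ℝ → ℝ} {A B c M : ℝ}

theorem volume_comb_near_int_le_of_pos (hf : ConvexArc f f₁ A B c M) {a b : ℝ}
    (hab : Set.Icc a b ⊆ Set.Icc A B) {K D η : ℝ} (hK : 0 < K) (hη0 : 0 ≤ η) (hη : η ≤ 1 / 4)
    (a₁ a₂ : ℝ) :
    volume {x | x ∈ {x | x ∈ Set.Icc a b ∧ K ≤ a₁ + a₂ * f₁ x ∧ a₁ + a₂ * f₁ x ≤ D} ∧
        ∃ n : ℤ, |(a₁ * x + a₂ * f x) - n| ≤ η} ≤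
      ENNReal.ofReal (2 * η / K) + ENNReal.ofReal (8 * η) *
        volume {x | x ∈ Set.Icc a b ∧ K ≤ a₁ + a₂ * f₁ x ∧ a₁ + a₂ * f₁ x ≤ D} := by
  have hd : ∀ x ∈ {x | x ∈ Set.Icc a b ∧ K ≤ a₁ + a₂ * f₁ x ∧ a₁ + a₂ * f₁ x ≤ D},
      HasDerivAt (fun x => a₁ * x + a₂ * f x) (a₁ + a₂ * f₁ x) x := by
    intro x hx
    simpa using hf.hasDerivAt_comb 0 a₁ a₂ (hab hx.1)
  have hmono := hf.strictMonoOn.monotoneOn.mono hab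
  rcases le_total 0 a₂ with h | h
  · have hm : MonotoneOn (fun x => a₁ + a₂ * f₁ x) (Set.Icc a b) := fun x hx y hy hxy => by
      have := mul_le_mul_of_nonneg_left (hmono hx hy hxy) h
      simpa using this
    refine volume_near_int_le_of_monotone ⟨fun x hx y hy z hz => ?_⟩ hd
      (hm.mono fun x hx => hx.1) hK (fun x hx => hx.2.1) hη0 hη
    have hz' : z ∈ Set.Icc a b := ⟨hx.1.1.trans hz.1, hz.2.trans hy.1.2⟩
    exact ⟨hz', hx.2.1.trans (hm hx.1 hz' hz.1), (hm hz' hy.1 hz.2).trans hy.2.2⟩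
  · have hm : AntitoneOn (fun x => a₁ + a₂ * f₁ x) (Set.Icc a b) := fun x hx y hy hxy => by
      have := mul_le_mul_of_nonpos_left (hmono hx hy hxy) h
      simpa using this
    refine volume_near_int_le_of_antitone ⟨fun x hx y hy z hz => ?_⟩ hd
      (hm.mono fun x hx => hx.1) hK (fun x hx => hx.2.1) hη0 hη
    have hz' : z ∈ Set.Icc a b := ⟨hx.1.1.trans hz.1, hz.2.trans hy.1.2⟩
    exact ⟨hz', hy.2.1.trans (hm hz' hy.1 hz.2), (hm hx.1 hz' hz.1).trans hx.2.2⟩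

theorem volume_comb_near_int_le (hf : ConvexArc f f₁ A B c M) {a b : ℝ}
    (hab : Set.Icc a b ⊆ Set.Icc A B) {K D η : ℝ} (hK : 0 < K) (hη0 : 0 ≤ η) (hη : η ≤ 1 / 4)
    (a₁ a₂ : ℝ) :
    volume {x | x ∈ Set.Icc a b ∧ K ≤ |a₁ + a₂ * f₁ x| ∧ |a₁ + a₂ * f₁ x| ≤ D ∧
        ∃ n : ℤ, |n + a₁ * x + a₂ * f x| ≤ η} ≤
      ENNReal.ofReal (4 * η / K) + ENNReal.ofReal (16 * η) *
        volume {x | x ∈ Set.Icc a b ∧ |a₁ + a₂ * f₁ x| ≤ D} := by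
  have h1 := hf.volume_comb_near_int_le_of_pos hab hK hη0 hη (D := D) a₁ a₂
  have h2 := hf.volume_comb_near_int_le_of_pos hab hK hη0 hη (D := D) (-a₁) (-a₂)
  set V := volume {x | x ∈ Set.Icc a b ∧ |a₁ + a₂ * f₁ x| ≤ D} with hV
  have hV1 : volume {x | x ∈ Set.Icc a b ∧ K ≤ a₁ + a₂ * f₁ x ∧ a₁ + a₂ * f₁ x ≤ D} ≤ V := by
    refine measure_mono fun x hx => ⟨hx.1, abs_le.2 ⟨?_, hx.2.2⟩⟩
    linarith [hx.2.1, hx.2.2]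
  have hV2 : volume {x | x ∈ Set.Icc a b ∧ K ≤ -a₁ + -a₂ * f₁ x ∧ -a₁ + -a₂ * f₁ x ≤ D} ≤ V := by
    refine measure_mono fun x hx => ⟨hx.1, abs_le.2 ⟨?_, ?_⟩⟩
    · linarith [hx.2.1, hx.2.2]
    · linarith [hx.2.1, hx.2.2]
  refine (measure_mono ?_).trans ((measure_union_le _ _).trans ((add_le_add h1 h2).trans ?_))
  · rintro x ⟨hx, hxK, hxD, n, hn⟩
    rcases le_total 0 (a₁ + a₂ * f₁ x) with h | h
    · rw [abs_of_nonneg h] at hxK hxD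
      refine Or.inl ⟨⟨hx, hxK, hxD⟩, -n, ?_⟩
      convert hn using 2
      push_cast; ring
    · rw [abs_of_nonpos h] at hxK hxD
      refine Or.inr ⟨⟨hx, by linarith, by linarith⟩, n, ?_⟩
      rw [← abs_neg]
      convert hn using 2
      ring
  · calc _ ≤ ENNReal.ofReal (2 * η / K) + ENNReal.ofReal (8 * η) * V +
          (ENNReal.ofReal (2 * η / K) + ENNReal.ofReal (8 * η) * V) := by gcongr
      _ = _ := by
        rw [show 4 * η / K = 2 * η / K + 2 * η / K by ring, show 16 * η = 8 * η + 8 * η by ring,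
          ENNReal.ofReal_add (by positivity) (by positivity),
          ENNReal.ofReal_add (by positivity) (by positivity)]
        ring

/-- For each point, few integer translates of a given number are small. -/
theorem sum_volume_abs_add_le {s : Finset ℤ} {g : ℝ → ℝ} {a b D : ℝ} (hD : 0 ≤ D)
    (hm : ∀ n : ℤ, MeasurableSet {x | x ∈ Set.Icc a b ∧ |n + g x| ≤ D}) :
    ∑ n ∈ s, volume {x | x ∈ Set.Icc a b ∧ |n + g x| ≤ D} ≤
      ENNReal.ofReal ((2 * D + 1) * (b - a)) := by
  have h1 : ∑ n ∈ s, volume {x | x ∈ Set.Icc a b ∧ |n + g x| ≤ D} =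
      ∫⁻ x, ∑ n ∈ s, Set.indicator {x | x ∈ Set.Icc a b ∧ |n + g x| ≤ D} 1 x := by
    rw [lintegral_finsetSum _ fun n _ => (measurable_one.indicator (hm n))]
    refine Finset.sum_congr rfl fun n _ => ?_
    rw [lintegral_indicator_one (hm n)]
  rw [h1, ENNReal.ofReal_mul (by linarith), ← Real.volume_Icc,
    ← lintegral_indicator_const measurableSet_Icc]
  refine lintegral_mono fun x => ?_
  by_cases hx : x ∈ Set.Icc a b
  · rw [Set.indicator_of_mem hx]
    have h2 : ∑ n ∈ s, Set.indicator {x | x ∈ Set.Icc a b ∧ |n + g x| ≤ D} (1 : ℝ → ENNReal) x =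
        ((s.filter fun n : ℤ => |n + g x| ≤ D).card : ENNReal) := by
      rw [Finset.card_filter, Nat.cast_sum]
      refine Finset.sum_congr rfl fun n _ => ?_
      by_cases h : |n + g x| ≤ D
      · rw [Set.indicator_of_mem (a := x) (And.intro hx h)]; simp [h]
      · rw [Set.indicator_of_notMem (a := x) fun h' => h h'.2]; simp [h]
    rw [h2, ← ENNReal.ofReal_natCast]
    apply ENNReal.ofReal_le_ofReal
    have h3 : (s.filter fun n : ℤ => |n + g x| ≤ D) ⊆ Finset.Icc ⌈-D - g x⌉ ⌊D - g x⌋ := by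
      intro n hn
      have := abs_le.1 (Finset.mem_filter.1 hn).2
      rw [Finset.mem_Icc, Int.ceil_le, Int.le_floor]
      exact ⟨by linarith, by linarith⟩
    have h4 := Finset.card_le_card h3
    rw [Int.card_Icc] at h4
    rcases le_total (⌊D - g x⌋ + 1 - ⌈-D - g x⌉) 0 with h | h
    · rw [Int.toNat_of_nonpos h] at h4
      have : (s.filter fun n : ℤ => |n + g x| ≤ D).card = 0 := by omega
      rw [this]; push_cast; linarith
    · have h5 : ((⌊D - g x⌋ + 1 - ⌈-D - g x⌉).toNat : ℝ) =
          ((⌊D - g x⌋ + 1 - ⌈-D - g x⌉ : ℤ) : ℝ) := by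
        exact_mod_cast Int.toNat_of_nonneg h
      have h6 : ((s.filter fun n : ℤ => |n + g x| ≤ D).card : ℝ) ≤
          ((⌊D - g x⌋ + 1 - ⌈-D - g x⌉ : ℤ) : ℝ) := by
        rw [← h5]; exact_mod_cast h4
      push_cast at h6
      linarith [Int.floor_le (D - g x), Int.le_ceil (-D - g x)]
  · rw [Set.indicator_of_notMem hx]
    refine le_of_eq (Finset.sum_eq_zero fun n _ => ?_)
    exact Set.indicator_of_notMem (fun h => hx h.1) _

theorem volume_resonant_le_of_le_deriv (hf : ConvexArc f f₁ A B c M) {a b : ℝ}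
    (hab : Set.Icc a b ⊆ Set.Icc A B) (hab' : a ≤ b) {K D η : ℝ} (hK : 0 < K) (hD : 0 ≤ D)
    (hη0 : 0 ≤ η) (hη : η ≤ 1 / 4) {N N₁ : ℕ} (hN : D + M * N ≤ N₁) :
    volume {x | x ∈ Set.Icc a b ∧ ∃ a₀ a₁ a₂ : ℤ, |(a₂ : ℝ)| ≤ N ∧ K ≤ |a₁ + a₂ * f₁ x| ∧
        |a₁ + a₂ * f₁ x| ≤ D ∧ |a₀ + a₁ * x + a₂ * f x| ≤ η} ≤
      ENNReal.ofReal ((2 * N + 1) * ((2 * N₁ + 1) * (4 * η / K) +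
        16 * η * ((2 * D + 1) * (b - a)))) := by
  let S : ℤ → ℤ → Set ℝ := fun a₂ a₁ => {x | x ∈ Set.Icc a b ∧ K ≤ |a₁ + a₂ * f₁ x| ∧
    |a₁ + a₂ * f₁ x| ≤ D ∧ ∃ n : ℤ, |n + a₁ * x + a₂ * f x| ≤ η}
  have hcov : {x | x ∈ Set.Icc a b ∧ ∃ a₀ a₁ a₂ : ℤ, |(a₂ : ℝ)| ≤ N ∧ K ≤ |a₁ + a₂ * f₁ x| ∧
      |a₁ + a₂ * f₁ x| ≤ D ∧ |a₀ + a₁ * x + a₂ * f x| ≤ η} ⊆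
      ⋃ a₂ ∈ Finset.Icc (-N : ℤ) N, ⋃ a₁ ∈ Finset.Icc (-N₁ : ℤ) N₁, S a₂ a₁ := by
    rintro x ⟨hx, a₀, a₁, a₂, h1, h2, h3, h4⟩
    refine Set.mem_biUnion (x := a₂) ?_ (Set.mem_biUnion (x := a₁) ?_ ⟨hx, h2, h3, a₀, h4⟩)
    · rw [Finset.mem_coe, Finset.mem_Icc, ← abs_le]; exact_mod_cast h1
    · rw [Finset.mem_coe, Finset.mem_Icc, ← abs_le]
      have h5 := abs_sub (a₁ + a₂ * f₁ x) (a₂ * f₁ x)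
      rw [add_sub_cancel_right, abs_mul] at h5
      have h6 : |(a₂ : ℝ)| * |f₁ x| ≤ N * M := by gcongr; exact hf.bound x (hab hx)
      have : |(a₁ : ℝ)| ≤ N₁ := by linarith
      exact_mod_cast this
  have hmono := hf.strictMonoOn.monotoneOn.mono hab
  have hmeas : ∀ a₂ n : ℤ, MeasurableSet {x | x ∈ Set.Icc a b ∧ |n + a₂ * f₁ x| ≤ D} := by
    intro a₂ n
    apply Set.OrdConnected.measurableSet
    refine ⟨fun x hx y hy z hz => ?_⟩
    have hz' : z ∈ Set.Icc a b := ⟨hx.1.1.trans hz.1, hz.2.trans hy.1.2⟩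
    refine ⟨hz', ?_⟩
    have h1 := abs_le.1 hx.2
    have h2 := abs_le.1 hy.2
    have h3 := hmono hx.1 hz' hz.1
    have h4 := hmono hz' hy.1 hz.2
    rw [abs_le]
    rcases le_total 0 (a₂ : ℝ) with h | h
    · have h5 := mul_le_mul_of_nonneg_left h3 h
      have h6 := mul_le_mul_of_nonneg_left h4 h
      exact ⟨by linarith, by linarith⟩
    · have h5 := mul_le_mul_of_nonpos_left h3 h
      have h6 := mul_le_mul_of_nonpos_left h4 h
      exact ⟨by linarith, by linarith⟩
  have hsum : ∀ a₂ ∈ Finset.Icc (-N : ℤ) N, ∑ a₁ ∈ Finset.Icc (-N₁ : ℤ) N₁, volume (S a₂ a₁) ≤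
      ENNReal.ofReal ((2 * N₁ + 1) * (4 * η / K) + 16 * η * ((2 * D + 1) * (b - a))) := by
    intro a₂ _
    have hba : 0 ≤ b - a := sub_nonneg.2 hab'
    calc ∑ a₁ ∈ Finset.Icc (-N₁ : ℤ) N₁, volume (S a₂ a₁)
        ≤ ∑ a₁ ∈ Finset.Icc (-N₁ : ℤ) N₁, (ENNReal.ofReal (4 * η / K) + ENNReal.ofReal (16 * η) *
          volume {x | x ∈ Set.Icc a b ∧ |a₁ + a₂ * f₁ x| ≤ D}) :=
          Finset.sum_le_sum fun a₁ _ => hf.volume_comb_near_int_le hab hK hη0 hη a₁ a₂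
      _ = ((2 * N₁ + 1 : ℕ) : ENNReal) * ENNReal.ofReal (4 * η / K) + ENNReal.ofReal (16 * η) *
          ∑ a₁ ∈ Finset.Icc (-N₁ : ℤ) N₁,
            volume {x | x ∈ Set.Icc a b ∧ |a₁ + a₂ * f₁ x| ≤ D} := by
          rw [Finset.sum_add_distrib, Finset.sum_const, Int.card_Icc, ← Finset.mul_sum,
            nsmul_eq_mul]
          congr 3
          omega
      _ ≤ ((2 * N₁ + 1 : ℕ) : ENNReal) * ENNReal.ofReal (4 * η / K) + ENNReal.ofReal (16 * η) *
          ENNReal.ofReal ((2 * D + 1) * (b - a)) := by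
          gcongr
          exact sum_volume_abs_add_le (g := fun x => a₂ * f₁ x) hD (hmeas a₂)
      _ = _ := by
          rw [← ENNReal.ofReal_natCast, ← ENNReal.ofReal_mul (by positivity),
            ← ENNReal.ofReal_mul (by positivity), ← ENNReal.ofReal_add (by positivity)
            (by positivity)]
          push_cast; rfl
  calc _ ≤ volume (⋃ a₂ ∈ Finset.Icc (-N : ℤ) N, ⋃ a₁ ∈ Finset.Icc (-N₁ : ℤ) N₁, S a₂ a₁) :=
        measure_mono hcov
    _ ≤ ∑ a₂ ∈ Finset.Icc (-N : ℤ) N, ∑ a₁ ∈ Finset.Icc (-N₁ : ℤ) N₁, volume (S a₂ a₁) :=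
        (measure_biUnion_finset_le _ _).trans
          (Finset.sum_le_sum fun a₂ _ => measure_biUnion_finset_le _ _)
    _ ≤ ∑ a₂ ∈ Finset.Icc (-N : ℤ) N, ENNReal.ofReal ((2 * N₁ + 1) * (4 * η / K) +
        16 * η * ((2 * D + 1) * (b - a))) := Finset.sum_le_sum hsum
    _ = _ := by
        rw [Finset.sum_const, Int.card_Icc, nsmul_eq_mul, ENNReal.ofReal_mul (by positivity)]
        congr 1
        rw [← ENNReal.ofReal_natCast]
        congr 1
        have : ((N : ℤ) + 1 - -N).toNat = 2 * N + 1 := by omega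
        rw [this]; push_cast; rfl

end ConvexArc

theorem exists_forall_le_of_nat {α : Type*} {P : α → Prop} (m : α → ℕ) (h : ∃ a, P a) :
    ∃ a, P a ∧ ∀ b, P b → m a ≤ m b := by
  obtain ⟨a, ha, ha'⟩ := WellFounded.has_min (measure m).wf {a | P a} h
  exact ⟨a, ha, fun b hb => not_lt.1 (ha' b hb)⟩

theorem exists_eq_mul_of_cross_eq_zero {a₀ a₁ a₂ b₀ b₁ b₂ : ℝ}
    (ha : a₀ ≠ 0 ∨ a₁ ≠ 0 ∨ a₂ ≠ 0) (h₀ : a₁ * b₂ - a₂ * b₁ = 0) (h₁ : a₂ * b₀ - a₀ * b₂ = 0)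
    (h₂ : a₀ * b₁ - a₁ * b₀ = 0) : ∃ l : ℝ, b₀ = l * a₀ ∧ b₁ = l * a₁ ∧ b₂ = l * a₂ := by
  rcases ha with h | h | h
  · refine ⟨b₀ / a₀, ?_, ?_, ?_⟩ <;> field_simp <;> linarith
  · refine ⟨b₁ / a₁, ?_, ?_, ?_⟩ <;> field_simp <;> linarith
  · refine ⟨b₂ / a₂, ?_, ?_, ?_⟩ <;> field_simp <;> linarith

/-- Points at which some nontrivial integer combination `a₀ + a₁ x + a₂ f x` and its derivative are
both small. -/
def resonantSet (f f₁ : ℝ → ℝ) (N K η : ℝ) : Set ℝ :=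
  {x | ∃ a₀ a₁ a₂ : ℤ, (a₁ ≠ 0 ∨ a₂ ≠ 0) ∧ |(a₂ : ℝ)| ≤ N ∧
    |a₁ + a₂ * f₁ x| ≤ K ∧ |a₀ + a₁ * x + a₂ * f x| ≤ η}

/-- Points at which two independent integer combinations are small. -/
def doublyResonantSet (f f₁ : ℝ → ℝ) (N K η : ℝ) : Set ℝ :=
  {x | ∃ a₀ a₁ a₂ b₀ b₁ b₂ : ℤ,
    (a₁ * b₂ - a₂ * b₁ ≠ 0 ∨ a₂ * b₀ - a₀ * b₂ ≠ 0 ∨ a₀ * b₁ - a₁ * b₀ ≠ 0) ∧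
    (|(a₂ : ℝ)| ≤ N ∧ |a₁ + a₂ * f₁ x| ≤ K ∧ |a₀ + a₁ * x + a₂ * f x| ≤ η) ∧
    (|(b₂ : ℝ)| ≤ N ∧ |b₁ + b₂ * f₁ x| ≤ K ∧ |b₀ + b₁ * x + b₂ * f x| ≤ η)}

namespace ConvexArc

variable {f f₁ : ℝ → ℝ} {A B c M : ℝ}

/-- Points that are close to a rational line with small slope defect, but not to two
independent ones, form a small set. -/
theorem volume_resonant_diff_le (hf : ConvexArc f f₁ A B c M) {a b : ℝ} {g η K K' N : ℝ}
    (hg : 1 ≤ g) (hη : 0 < η) (hgη : g ^ 2 * η ≤ 1) (ha : A ≤ a - 5 * (g * √η))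
    (hb : b + 5 * (g * √η) ≤ B) (hN : 0 ≤ N) (hK : K + N * (M * (5 * (g * √η))) ≤ K') :
    volume ((Set.Icc a b ∩ resonantSet f f₁ N K η) \
        doublyResonantSet f f₁ N K' (20 * M * (g ^ 2 * η))) ≤
      ENNReal.ofReal ((60 * M / √c + 8) / g / 2 * (b - a + 2 * (g * √η))) := by
  have hc := hf.c_pos
  have hM := hf.one_le
  have hη0 := Real.sqrt_pos.2 hη
  have hg0 : 0 < g := by linarith
  have hgs : 0 < g * √η := by positivity
  set E := (Set.Icc a b ∩ resonantSet f f₁ N K η) \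
    doublyResonantSet f f₁ N K' (20 * M * (g ^ 2 * η)) with hE
  let W : ℝ → ℤ × ℤ × ℤ → Prop := fun x v => (v.2.1 ≠ 0 ∨ v.2.2 ≠ 0) ∧ |(v.2.2 : ℝ)| ≤ N ∧
        |v.2.1 + v.2.2 * f₁ x| ≤ K ∧ |v.1 + v.2.1 * x + v.2.2 * f x| ≤ η
  have hmin : ∀ x ∈ E, ∃ v, W x v ∧ ∀ w, W x w →
      v.1.natAbs + v.2.1.natAbs + v.2.2.natAbs ≤ w.1.natAbs + w.2.1.natAbs + w.2.2.natAbs := by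
    rintro x ⟨⟨-, a₀, a₁, a₂, h⟩, -⟩
    exact exists_forall_le_of_nat (fun v : ℤ × ℤ × ℤ => v.1.natAbs + v.2.1.natAbs + v.2.2.natAbs)
      ⟨(a₀, a₁, a₂), h⟩
  have hrad : ∀ x ∈ E, ∃ r, 0 < r ∧ r ≤ g * √η ∧
      volume (E ∩ Metric.closedBall x (5 * r)) ≤
        ENNReal.ofReal ((60 * M / √c + 8) / g / 2 * (2 * r)) := by
    intro x hx
    have hxab := hx.1.1
    obtain ⟨⟨a₀, a₁, a₂⟩, ⟨h0, h1, h2, h3⟩, hmin⟩ := hmin x hx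
    simp only at h0 h1 h2 h3 hmin
    obtain ⟨r, hr0, hrg, hr1, hr2, hr3⟩ := hf.exists_good_radius hg hη hgη h0 (a₀ := a₀) (x := x)
      (Set.Icc_subset_Icc (by linarith [hxab.1]) (by linarith [hxab.2]))
    refine ⟨r, hr0, hrg, (measure_mono ?_).trans (hr3.trans (le_of_eq ?_))⟩
    · rintro y ⟨hy, hyx⟩
      rw [Real.closedBall_eq_Icc] at hyx
      refine ⟨hyx, ?_⟩
      have hyab := hy.1.1
      have hxAB : x ∈ Set.Icc A B := ⟨by linarith [hxab.1], by linarith [hxab.2]⟩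
      have hyAB : y ∈ Set.Icc A B := ⟨by linarith [hyab.1], by linarith [hyab.2]⟩
      have hd : |y - x| ≤ 5 * r := abs_le.2 ⟨by linarith [hyx.1], by linarith [hyx.2]⟩
      obtain ⟨⟨-, b₀, b₁, b₂, k0, k1, k2, k3⟩, hy2⟩ := hy
      have hηg : η ≤ g ^ 2 * η := le_mul_of_one_le_left hη.le (one_le_pow₀ hg)
      have hgη0 : 0 < g ^ 2 * η := by positivity
      have e1 : |(a₀ : ℝ) + a₁ * y + a₂ * f y| ≤ 20 * M * (g ^ 2 * η) := by
        refine (hf.abs_comb_le hxAB hyAB a₀ a₁ a₂).trans ?_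
        have e2 : |a₁ + a₂ * f₁ x| * |y - x| ≤ 5 * (g ^ 2 * η) := by
          calc _ ≤ |a₁ + a₂ * f₁ x| * (5 * r) := by gcongr
            _ ≤ _ := by linarith
        have e3 : |(a₂ : ℝ)| * (M / 2 * (y - x) ^ 2) ≤ 25 / 2 * M * (g ^ 2 * η) := by
          have : (y - x) ^ 2 ≤ (5 * r) ^ 2 := sq_le_sq' (by linarith [hyx.1]) (by linarith [hyx.2])
          calc _ ≤ |(a₂ : ℝ)| * (M / 2 * (5 * r) ^ 2) := by gcongr
            _ = 25 / 2 * M * (|(a₂ : ℝ)| * r ^ 2) := by ring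
            _ ≤ _ := by gcongr
        nlinarith
      have e4 : |(a₁ : ℝ) + a₂ * f₁ y| ≤ K' := by
        have e5 := hf.abs_deriv_comb_le hxAB hyAB a₁ a₂
        have e6 : |(a₂ : ℝ)| * (M * |y - x|) ≤ N * (M * (5 * (g * √η))) := by
          gcongr; linarith
        have e7 := abs_sub_abs_le_abs_sub ((a₁ : ℝ) + a₂ * f₁ y) (a₁ + a₂ * f₁ x)
        linarith
      have hcross : a₁ * b₂ - a₂ * b₁ = 0 ∧ a₂ * b₀ - a₀ * b₂ = 0 ∧ a₀ * b₁ - a₁ * b₀ = 0 := by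
        by_contra hcon
        refine hy2 ⟨a₀, a₁, a₂, b₀, b₁, b₂, by tauto, ⟨h1, e4, e1⟩, k1, ?_, ?_⟩
        · have : 0 ≤ N * (M * (5 * (g * √η))) := by positivity
          linarith
        · nlinarith
      obtain ⟨l, l0, l1, l2⟩ := exists_eq_mul_of_cross_eq_zero (a₀ := (a₀ : ℝ)) (a₁ := a₁)
        (a₂ := a₂) (b₀ := b₀) (b₁ := b₁) (b₂ := b₂)
        (Or.inr (by exact_mod_cast h0)) (by exact_mod_cast hcross.1)
        (by exact_mod_cast hcross.2.1) (by exact_mod_cast hcross.2.2)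
      have hl : 1 ≤ |l| := by
        by_contra! hl
        have hmul : ∀ t : ℝ, |l * t| ≤ |t| := fun t => by
          rw [abs_mul]; nlinarith [abs_nonneg t, abs_nonneg l]
        have := hmin (b₀, b₁, b₂) ⟨k0, by simp only; rw [l2]; exact (hmul _).trans h1, ?_, ?_⟩
        · have n0 : |(b₀ : ℝ)| = |l| * |(a₀ : ℝ)| := by rw [l0, abs_mul]
          have n1 : |(b₁ : ℝ)| = |l| * |(a₁ : ℝ)| := by rw [l1, abs_mul]
          have n2 : |(b₂ : ℝ)| = |l| * |(a₂ : ℝ)| := by rw [l2, abs_mul]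
          simp only at this
          have h5 : |(a₀ : ℝ)| + |(a₁ : ℝ)| + |(a₂ : ℝ)| ≤
              |(b₀ : ℝ)| + |(b₁ : ℝ)| + |(b₂ : ℝ)| := by
            have := (Nat.cast_le (α := ℝ)).2 this
            push_cast at this
            simpa only [Nat.cast_natAbs, Int.cast_abs] using this
          have h6 : 0 < |(a₀ : ℝ)| + |(a₁ : ℝ)| + |(a₂ : ℝ)| := by
            rcases h0 with h | h
            · have : 0 < |(a₁ : ℝ)| := abs_pos.2 (by exact_mod_cast h)
              positivity
            · have : 0 < |(a₂ : ℝ)| := abs_pos.2 (by exact_mod_cast h)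
              positivity
          rw [n0, n1, n2, ← mul_add, ← mul_add] at h5
          nlinarith
        · simp only
          rw [l1, l2, mul_assoc, ← mul_add]
          exact (hmul _).trans h2
        · simp only
          rw [l0, l1, l2, mul_assoc, mul_assoc, ← mul_add, ← mul_add]
          exact (hmul _).trans h3
      rw [l0, l1, l2, mul_assoc, mul_assoc, ← mul_add, ← mul_add, abs_mul] at k3
      exact (le_mul_of_one_le_left (abs_nonneg _) hl).trans k3
    · congr 1; ring
  choose! r hr0 hrg hr using hrad
  exact volume_le_of_local_density (by positivity) (fun x hx => hx.1.1) hr0 hrg hr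

end ConvexArc

/-- Points close to a rational point of denominator at most `Q` lying near the graph. -/
def nearRationalSet (f f₁ : ℝ → ℝ) (Q d e : ℝ) : Set ℝ :=
  {x | ∃ q p s : ℤ, 1 ≤ q ∧ (q : ℝ) ≤ Q ∧ |q * x - p| ≤ d ∧ |tangentForm f f₁ q p s x| ≤ e}

theorem doublyResonantSet_subset {f f₁ : ℝ → ℝ} {N K η : ℝ} (hN : 2 * N * η < 1)
    (hK : 2 * K * η < 1) :
    doublyResonantSet f f₁ N K η ⊆ nearRationalSet f f₁ (2 * N * K) (2 * N * η) (2 * K * η) := by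
  rintro x ⟨a₀, a₁, a₂, b₀, b₁, b₂, hne, ⟨ha1, ha2, ha3⟩, ⟨hb1, hb2, hb3⟩⟩
  have hprod : ∀ {u v U V u' v' : ℝ}, |u| ≤ U → |v| ≤ V → |u'| ≤ U → |v'| ≤ V →
      |u * v - u' * v'| ≤ 2 * U * V := by
    intro u v U V u' v' hu hv hu' hv'
    have hU : 0 ≤ U := (abs_nonneg _).trans hu
    refine (abs_sub _ _).trans ?_
    rw [abs_mul, abs_mul]
    have h1 : |u| * |v| ≤ U * V := by gcongr
    have h2 : |u'| * |v'| ≤ U * V := by gcongr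
    linarith
  have key : ∃ q p s : ℤ, (q ≠ 0 ∨ p ≠ 0 ∨ s ≠ 0) ∧ |(q : ℝ)| ≤ 2 * N * K ∧
      |q * x - p| ≤ 2 * N * η ∧ |tangentForm f f₁ q p s x| ≤ 2 * K * η := by
    refine ⟨_, _, _, hne, ?_, ?_, ?_⟩
    · convert hprod hb1 ha2 ha1 hb2 using 2
      push_cast; ring
    · convert hprod hb1 ha3 ha1 hb3 using 2
      push_cast; ring
    · convert hprod ha2 hb3 hb2 ha3 using 2
      unfold tangentForm; push_cast; ring
  obtain ⟨q, p, s, hne, hq, hd, hh⟩ := key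
  have hq0 : q ≠ 0 := by
    rintro rfl
    have hp : p = 0 := by
      have := hd.trans_lt hN
      rw [Int.cast_zero, zero_mul, zero_sub, abs_neg] at this
      exact Int.abs_lt_one_iff.1 (by exact_mod_cast this)
    subst hp
    have hs : s = 0 := by
      have := hh.trans_lt hK
      simp only [tangentForm, Int.cast_zero, zero_mul, zero_sub, sub_zero, mul_zero,
        abs_neg] at this
      exact Int.abs_lt_one_iff.1 (by exact_mod_cast this)
    simp [hs] at hne
  rcases lt_or_gt_of_ne hq0 with h | h
  · refine ⟨-q, -p, -s, by omega, ?_, ?_, ?_⟩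
    · push_cast; exact (neg_le_abs _).trans hq
    · rw [← abs_neg] at hd; convert hd using 2; push_cast; ring
    · rw [← abs_neg] at hh; convert hh using 2; unfold tangentForm; push_cast; ring
  · exact ⟨q, p, s, by omega, (le_abs_self _).trans hq, hd, hh⟩

namespace ConvexArc

variable {f f₁ : ℝ → ℝ} {A B c M : ℝ}

theorem abs_mul_apply_div_sub_le (hf : ConvexArc f f₁ A B c M) {x d e : ℝ} {q p s : ℤ}
    (hx : x ∈ Set.Icc A B) (hq : 1 ≤ q) (hp : (p / q : ℝ) ∈ Set.Icc A B)
    (hd : |q * x - p| ≤ d) (he : |tangentForm f f₁ q p s x| ≤ e) :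
    |q * f (p / q) - s| ≤ e + M * d ^ 2 := by
  have hM := hf.one_le
  have hq1 : (1 : ℝ) ≤ q := by exact_mod_cast hq
  have hq0 : (0 : ℝ) < q := by linarith
  have h : (q : ℝ) * f (p / q) - s = tangentForm f f₁ q p s x +
      q * (f (p / q) - f x - f₁ x * (p / q - x)) := by
    unfold tangentForm; field_simp; ring
  have h1 := hf.abs_taylor hx hp
  have h2 : (q : ℝ) * (M / 2 * (p / q - x) ^ 2) ≤ M * d ^ 2 := by
    have h3 : (q * x - p) ^ 2 ≤ d ^ 2 := by
      rw [← sq_abs]; gcongr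
    have h4 : (q : ℝ) * (M / 2 * (p / q - x) ^ 2) = M * (q * x - p) ^ 2 / (2 * q) := by
      field_simp; ring
    rw [h4, div_le_iff₀ (by positivity)]
    have h5 : 0 ≤ M * d ^ 2 := by positivity
    nlinarith
  rw [h]
  refine (abs_add_le _ _).trans (add_le_add he ?_)
  rw [abs_mul, abs_of_pos hq0]
  exact (by gcongr : (q : ℝ) * |f (p / q) - f x - f₁ x * (p / q - x)| ≤ _).trans h2

/-- Three rational points of the same denominator very close to the graph cannot be close to each
other. -/
theorem lt_sub_of_near_graph (hf : ConvexArc f f₁ A B c M) {q p p' p'' s s' s'' L : ℤ} {ε : ℝ}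
    (hp : (p / q : ℝ) ∈ Set.Icc A B) (hp' : (p' / q : ℝ) ∈ Set.Icc A B)
    (hp'' : (p'' / q : ℝ) ∈ Set.Icc A B) (hlt : p < p') (hlt' : p' < p'')
    (hs : |q * f (p / q) - s| ≤ ε) (hs' : |q * f (p' / q) - s'| ≤ ε)
    (hs'' : |q * f (p'' / q) - s''| ≤ ε) (hq0 : 0 < q) (hqL : M * L ^ 3 ≤ q)
    (hε : 2 * L * ε * q < c) : L < p'' - p := by
  by_contra! hL
  have hq : (0 : ℝ) < q := by exact_mod_cast hq0
  have hM := hf.one_le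
  have hc := hf.c_pos
  set t : ℝ := p' - p with ht
  set u : ℝ := p'' - p' with hu
  have ht1 : 1 ≤ t := by rw [ht]; exact_mod_cast (by omega : (1 : ℤ) ≤ p' - p)
  have hu1 : 1 ≤ u := by rw [hu]; exact_mod_cast (by omega : (1 : ℤ) ≤ p'' - p')
  have htu : t + u ≤ L := by
    have : ((p'' - p : ℤ) : ℝ) ≤ L := by exact_mod_cast hL
    push_cast at this
    linarith
  have ht0 : 0 ≤ t := by linarith
  have hu0 : 0 ≤ u := by linarith
  have htL : t ≤ L := by linarith
  have huL : u ≤ L := by linarith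
  have hL0 : (0 : ℝ) ≤ L := by linarith
  have hε0 : 0 ≤ ε := (abs_nonneg _).trans hs
  set R₁ := f (p / q) - f (p' / q) - f₁ (p' / q) * (p / q - p' / q) with hR₁
  set R₂ := f (p'' / q) - f (p' / q) - f₁ (p' / q) * (p'' / q - p' / q) with hR₂
  have e1 : ((p : ℝ) / q - p' / q) ^ 2 = t ^ 2 / q ^ 2 := by rw [ht]; field_simp; ring
  have e2 : ((p'' : ℝ) / q - p' / q) ^ 2 = u ^ 2 / q ^ 2 := by rw [hu]; field_simp
  have l1 := hf.taylor_lower hp' hp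
  have l2 := hf.taylor_lower hp' hp''
  have u1 := hf.taylor_upper hp' hp
  have u2 := hf.taylor_upper hp' hp''
  rw [← hR₁, e1] at l1 u1
  rw [← hR₂, e2] at l2 u2
  set m : ℤ := (p'' - p') * s + (p' - p) * s'' - (p'' - p) * s' with hm
  have hmV : |q * (u * R₁ + t * R₂) - m| ≤ 2 * L * ε := by
    have h1 : q * (u * R₁ + t * R₂) - m = u * (q * f (p / q) - s) + t * (q * f (p'' / q) - s'') -
        (t + u) * (q * f (p' / q) - s') := by
      rw [hm, hR₁, hR₂, ht, hu]; push_cast; field_simp; ring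
    rw [h1]
    refine (abs_sub _ _).trans ((add_le_add_left (abs_add_le _ _) _).trans ?_)
    rw [abs_mul, abs_mul, abs_mul, abs_of_pos (by linarith : 0 < u),
      abs_of_pos (by linarith : 0 < t), abs_of_pos (by linarith : 0 < t + u)]
    have h2 : u * |q * f (p / q) - s| ≤ u * ε := by gcongr
    have h3 : t * |q * f (p'' / q) - s''| ≤ t * ε := by gcongr
    have h4 : (t + u) * |q * f (p' / q) - s'| ≤ (t + u) * ε := by gcongr
    nlinarith
  have htu1 : 1 ≤ t * u := one_le_mul_of_one_le_of_one_le ht1 hu1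
  have htu2 : 1 ≤ (t * u) * (t + u) / 2 := by
    have : 1 * 2 ≤ (t * u) * (t + u) := mul_le_mul htu1 (by linarith) (by norm_num) (by linarith)
    linarith
  have hlow : c / q ≤ q * (u * R₁ + t * R₂) := by
    calc c / q ≤ c * ((t * u) * (t + u) / 2) / q := by
          gcongr
          exact le_mul_of_one_le_right hc.le htu2
      _ = q * (u * (c / 2 * (t ^ 2 / q ^ 2)) + t * (c / 2 * (u ^ 2 / q ^ 2))) := by
          field_simp
      _ ≤ _ := by gcongr
  have hupp : q * (u * R₁ + t * R₂) ≤ 1 / 2 := by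
    calc q * (u * R₁ + t * R₂) ≤
          q * (u * (M / 2 * (t ^ 2 / q ^ 2)) + t * (M / 2 * (u ^ 2 / q ^ 2))) := by gcongr
      _ = (M * ((t * u) * (t + u))) / q / 2 := by field_simp
      _ ≤ (M * (L * L * L)) / q / 2 := by
          gcongr
      _ ≤ 1 / 2 := by
          gcongr
          rw [div_le_one hq]
          rwa [show (L : ℝ) * L * L = L ^ 3 by ring]
  have hc' : 2 * L * ε < c / q := by rwa [lt_div_iff₀ hq]
  rw [abs_le] at hmV
  have hm0 : (0 : ℝ) < m := by linarith
  have hm1 : (1 : ℝ) ≤ m := by exact_mod_cast hm0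
  linarith

end ConvexArc

theorem Int.card_le_two_mul_of_gap {P : Finset ℤ} {L : ℤ} (hL : 0 < L) {u v : ℝ} (huv : u ≤ v)
    (hP : ∀ p ∈ P, u ≤ p ∧ (p : ℝ) ≤ v)
    (hgap : ∀ p ∈ P, ∀ p' ∈ P, ∀ p'' ∈ P, p < p' → p' < p'' → L < p'' - p) :
    (P.card : ℝ) ≤ 2 * ((v - u) / L + 2) := by
  have hLr : (0 : ℝ) < L := by exact_mod_cast hL
  have h1 : P.card ≤ 2 * (P.image fun p => p / L).card := by
    apply Finset.card_le_mul_card_image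
    intro k _
    by_contra! h
    obtain ⟨x, y, z, hx, hy, hz, hxy, hxz, hyz⟩ := Finset.two_lt_card_iff.1 h
    rw [Finset.mem_filter] at hx hy hz
    have hb : ∀ w : ℤ, w / L = k → k * L ≤ w ∧ w < k * L + L := by
      rintro w rfl
      have e1 := Int.mul_ediv_add_emod w L
      have e2 := Int.emod_nonneg w hL.ne'
      have e3 := Int.emod_lt_of_pos w hL
      rw [mul_comm] at e1
      constructor <;> linarith
    have bx := hb x hx.2
    have bymem := hb y hy.2
    have bz := hb z hz.2
    have hgap' : ∀ p ∈ P, ∀ p' ∈ P, ∀ p'' ∈ P, p < p' → p' < p'' → ¬ (p'' - p < L) :=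
      fun p hp p' hp' p'' hp'' h h' => by have := hgap p hp p' hp' p'' hp'' h h'; omega
    rcases lt_or_gt_of_ne hxy with h1 | h1 <;> rcases lt_or_gt_of_ne hxz with h2 | h2 <;>
      rcases lt_or_gt_of_ne hyz with h3 | h3
    · exact hgap' x hx.1 y hy.1 z hz.1 h1 h3 (by omega)
    · exact hgap' x hx.1 z hz.1 y hy.1 h2 h3 (by omega)
    · omega
    · exact hgap' z hz.1 x hx.1 y hy.1 h2 h1 (by omega)
    · exact hgap' y hy.1 x hx.1 z hz.1 h1 h2 (by omega)
    · omega
    · exact hgap' y hy.1 z hz.1 x hx.1 h3 h2 (by omega)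
    · exact hgap' z hz.1 y hy.1 x hx.1 h3 h1 (by omega)
  have h2 : (P.image fun p => p / L) ⊆ Finset.Icc ⌊u / L⌋ ⌊v / L⌋ := by
    intro k hk
    obtain ⟨p, hp, rfl⟩ := Finset.mem_image.1 hk
    obtain ⟨hup, hpv⟩ := hP p hp
    rw [Finset.mem_Icc, Int.le_ediv_iff_mul_le hL, Int.le_floor, le_div_iff₀ hLr]
    constructor
    · have h : (⌊u / L⌋ : ℝ) * L ≤ p := ((le_div_iff₀ hLr).1 (Int.floor_le _)).trans hup
      exact_mod_cast h
    · have h : ((p / L * L : ℤ) : ℝ) ≤ p := by exact_mod_cast Int.ediv_mul_le p hL.ne'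
      push_cast at h
      exact h.trans hpv
  have h3 := Finset.card_le_card h2
  rw [Int.card_Icc] at h3
  have h4 : ⌊u / L⌋ ≤ ⌊v / L⌋ := Int.floor_mono (by gcongr)
  have h5 : (((⌊v / L⌋ + 1 - ⌊u / L⌋).toNat : ℕ) : ℝ) = ((⌊v / L⌋ + 1 - ⌊u / L⌋ : ℤ) : ℝ) := by
    exact_mod_cast Int.toNat_of_nonneg (by omega)
  have h6 : (P.card : ℝ) ≤ 2 * ((⌊v / L⌋ + 1 - ⌊u / L⌋ : ℤ) : ℝ) := by
    rw [← h5]; exact_mod_cast h1.trans (by omega)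
  push_cast at h6
  have := Int.floor_le (v / L)
  have := Int.lt_floor_add_one (u / L)
  rw [sub_div]
  linarith

namespace ConvexArc

variable {f f₁ : ℝ → ℝ} {A B c M : ℝ}

/-- The part of `nearRationalSet` with a given denominator. -/
theorem volume_nearRational_denom_le (hf : ConvexArc f f₁ A B c M) {a b d e ε : ℝ} (hab : a ≤ b)
    (hd0 : 0 ≤ d) (hd1 : d ≤ 1) (ha : A ≤ a - d) (hb : b + d ≤ B) {L : ℤ} (hL : 0 < L)
    (he : e + M * d ^ 2 ≤ ε) {q : ℕ} (hq : 1 ≤ q)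
    (hε : 2 * L * ε * q < c) :
    volume {x | x ∈ Set.Icc a b ∧ ∃ p s : ℤ, |q * x - p| ≤ d ∧ |tangentForm f f₁ q p s x| ≤ e} ≤
      ENNReal.ofReal (4 * d * (b - a + 4) / L) +
        if (q : ℝ) < M * L ^ 3 then ENNReal.ofReal (4 * d * (b - a + 4)) else 0 := by
  classical
  have hM := hf.one_le
  have hq1 : (1 : ℝ) ≤ q := by exact_mod_cast hq
  have hq0 : (0 : ℝ) < q := by linarith
  have hL1 : (1 : ℝ) ≤ L := by exact_mod_cast hL
  have hL0 : (0 : ℝ) < L := by linarith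
  have hba : 0 ≤ b - a := sub_nonneg.2 hab
  set P : Finset ℤ := (Finset.Icc ⌈q * a - d⌉ ⌊q * b + d⌋).filter fun p => ∃ s : ℤ,
    ∃ x ∈ Set.Icc a b, |q * x - p| ≤ d ∧ |tangentForm f f₁ q p s x| ≤ e with hP
  have hPmem : ∀ p ∈ P, (q * a - d ≤ p ∧ p ≤ q * b + d) ∧ ∃ s : ℤ,
      ∃ x ∈ Set.Icc a b, |q * x - p| ≤ d ∧ |tangentForm f f₁ q p s x| ≤ e := by
    intro p hp
    rw [hP, Finset.mem_filter, Finset.mem_Icc, Int.ceil_le, Int.le_floor] at hp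
    exact hp
  have hvol : volume {x | x ∈ Set.Icc a b ∧ ∃ p s : ℤ, |q * x - p| ≤ d ∧
      |tangentForm f f₁ q p s x| ≤ e} ≤ ENNReal.ofReal (P.card * (2 * (d / q))) := by
    calc _ ≤ volume (⋃ p ∈ P, Metric.closedBall ((p : ℝ) / q) (d / q)) := by
          refine measure_mono ?_
          rintro x ⟨hx, p, s, h1, h2⟩
          have h3 := abs_le.1 h1
          refine Set.mem_biUnion (x := p) ?_ ?_
          · rw [Finset.mem_coe, hP, Finset.mem_filter, Finset.mem_Icc, Int.ceil_le, Int.le_floor]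
            have h4 : q * a ≤ q * x := by gcongr; exact hx.1
            have h5 : q * x ≤ q * b := by gcongr; exact hx.2
            exact ⟨⟨by linarith, by linarith⟩, s, x, hx, h1, h2⟩
          · rw [Metric.mem_closedBall, Real.dist_eq,
              show x - (p : ℝ) / q = (q * x - p) / q by field_simp, abs_div, abs_of_pos hq0]
            gcongr
      _ ≤ ∑ p ∈ P, volume (Metric.closedBall ((p : ℝ) / q) (d / q)) :=
          measure_biUnion_finset_le _ _
      _ = _ := by
          simp_rw [Real.volume_closedBall]
          rw [Finset.sum_const, nsmul_eq_mul, ENNReal.ofReal_mul (p := (P.card : ℝ))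
            (by positivity), ENNReal.ofReal_natCast]
  refine hvol.trans ?_
  have hqq : q * a - d ≤ q * b + d := by
    have : q * a ≤ q * b := by gcongr
    linarith
  by_cases hqL : (q : ℝ) < M * L ^ 3
  · rw [if_pos hqL]
    refine le_trans ?_ le_add_self
    apply ENNReal.ofReal_le_ofReal
    have h1 : (P.card : ℝ) ≤ q * (b - a) + 3 := by
      have h2 : P.card ≤ (⌊q * b + d⌋ + 1 - ⌈q * a - d⌉).toNat := by
        rw [← Int.card_Icc]; exact Finset.card_filter_le _ _
      rcases le_total (⌊q * b + d⌋ + 1 - ⌈q * a - d⌉) 0 with h | h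
      · rw [Int.toNat_of_nonpos h] at h2
        have : P.card = 0 := by omega
        rw [this]; push_cast; positivity
      · have h3 : ((P.card : ℤ) : ℝ) ≤ ((⌊q * b + d⌋ + 1 - ⌈q * a - d⌉ : ℤ) : ℝ) := by
          exact_mod_cast (by omega : (P.card : ℤ) ≤ _)
        push_cast at h3
        linarith [Int.floor_le (q * b + d), Int.le_ceil (q * a - d)]
    calc P.card * (2 * (d / q)) ≤ (q * (b - a) + 3) * (2 * (d / q)) := by gcongr
      _ = 2 * d * (b - a) + 6 * d / q := by field_simp; ring
      _ ≤ 2 * d * (b - a) + 6 * d / 1 := by gcongr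
      _ ≤ _ := by nlinarith [mul_nonneg hd0 hba]
  · rw [if_neg hqL, add_zero]
    apply ENNReal.ofReal_le_ofReal
    push Not at hqL
    have hLq : (L : ℝ) ≤ q := by
      refine le_trans ?_ hqL
      calc (L : ℝ) = 1 * L ^ 1 := by ring
        _ ≤ M * L ^ 3 := by gcongr; norm_num
    have hcard := Int.card_le_two_mul_of_gap hL hqq (fun p hp => (hPmem p hp).1) (by
      intro p hp p' hp' p'' hp'' hlt hlt'
      have key : ∀ p ∈ P, (p / (q : ℤ) : ℝ) ∈ Set.Icc A B ∧
          ∃ s : ℤ, |((q : ℤ) : ℝ) * f (p / (q : ℤ)) - s| ≤ ε := by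
        intro p hp
        obtain ⟨-, s, x, hx, h1, h2⟩ := hPmem p hp
        have h3 : |x - p / q| ≤ d := by
          rw [show x - (p : ℝ) / q = (q * x - p) / q by field_simp, abs_div, abs_of_pos hq0]
          exact (div_le_self (abs_nonneg _) hq1).trans h1
        rw [abs_le] at h3
        have hpAB : (p / (q : ℤ) : ℝ) ∈ Set.Icc A B := by
          rw [Int.cast_natCast]
          exact ⟨by linarith [hx.1], by linarith [hx.2]⟩
        exact ⟨hpAB, s, (hf.abs_mul_apply_div_sub_le ⟨by linarith [hx.1], by linarith [hx.2]⟩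
          (by exact_mod_cast hq) hpAB (by exact_mod_cast h1) h2).trans he⟩
      obtain ⟨m, s, hs⟩ := key p hp
      obtain ⟨m', s', hs'⟩ := key p' hp'
      obtain ⟨m'', s'', hs''⟩ := key p'' hp''
      exact hf.lt_sub_of_near_graph m m' m'' hlt hlt' hs hs' hs'' (by exact_mod_cast hq)
        (by exact_mod_cast hqL) (by exact_mod_cast hε))
    have h2 : q * b + d - (q * a - d) ≤ q * (b - a) + 2 := by linarith
    calc P.card * (2 * (d / q)) ≤ (2 * ((q * (b - a) + 2) / L + 2)) * (2 * (d / q)) := by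
          refine mul_le_mul_of_nonneg_right (hcard.trans ?_) (by positivity)
          gcongr
      _ = 4 * d * ((b - a) / L + 2 / L / q + 2 / q) := by field_simp; ring
      _ ≤ 4 * d * ((b - a) / L + 2 / L / 1 + 2 / L) := by gcongr
      _ = _ := by ring

theorem volume_nearRational_le (hf : ConvexArc f f₁ A B c M) {a b Q d e ε : ℝ} (hab : a ≤ b)
    (hd0 : 0 ≤ d) (hd1 : d ≤ 1) (ha : A ≤ a - d) (hb : b + d ≤ B) {L : ℤ} (hL : 0 < L)
    (he0 : 0 ≤ e) (he : e + M * d ^ 2 ≤ ε) (hQ : 0 ≤ Q) (hε : 2 * L * ε * Q < c) :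
    volume (Set.Icc a b ∩ nearRationalSet f f₁ Q d e) ≤
      ENNReal.ofReal (4 * d * (b - a + 4) * (M * L ^ 3 + Q / L)) := by
  classical
  have hM := hf.one_le
  have hL1 : (1 : ℝ) ≤ L := by exact_mod_cast hL
  have hε0 : 0 ≤ ε := le_trans (by positivity) he
  have hba : 0 ≤ b - a := sub_nonneg.2 hab
  let S : ℕ → Set ℝ := fun q => {x | x ∈ Set.Icc a b ∧ ∃ p s : ℤ, |q * x - p| ≤ d ∧
    |tangentForm f f₁ q p s x| ≤ e}
  have hcov : Set.Icc a b ∩ nearRationalSet f f₁ Q d e ⊆ ⋃ q ∈ Finset.Icc 1 ⌊Q⌋₊, S q := by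
    rintro x ⟨hx, q, p, s, hq1, hqQ, h1, h2⟩
    lift q to ℕ using by omega
    refine Set.mem_biUnion (x := q) ?_ ⟨hx, p, s, by exact_mod_cast h1, h2⟩
    rw [Finset.mem_coe, Finset.mem_Icc]
    exact ⟨by exact_mod_cast hq1, Nat.le_floor (by exact_mod_cast hqQ)⟩
  have hcard : (((Finset.Icc 1 ⌊Q⌋₊).filter fun q : ℕ => (q : ℝ) < M * L ^ 3).card : ℝ) ≤
      M * L ^ 3 := by
    have h1 : ((Finset.Icc 1 ⌊Q⌋₊).filter fun q : ℕ => (q : ℝ) < M * L ^ 3) ⊆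
        Finset.Icc 1 ⌊M * (L : ℝ) ^ 3⌋₊ := by
      intro q hq
      rw [Finset.mem_filter, Finset.mem_Icc] at hq
      rw [Finset.mem_Icc]
      exact ⟨hq.1.1, Nat.le_floor hq.2.le⟩
    have h2 := Finset.card_le_card h1
    rw [Nat.card_Icc, Nat.add_sub_cancel] at h2
    exact le_trans (by exact_mod_cast h2) (Nat.floor_le (by positivity))
  calc _ ≤ volume (⋃ q ∈ Finset.Icc 1 ⌊Q⌋₊, S q) := measure_mono hcov
    _ ≤ ∑ q ∈ Finset.Icc 1 ⌊Q⌋₊, volume (S q) := measure_biUnion_finset_le _ _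
    _ ≤ ∑ q ∈ Finset.Icc 1 ⌊Q⌋₊, (ENNReal.ofReal (4 * d * (b - a + 4) / L) +
        if (q : ℝ) < M * L ^ 3 then ENNReal.ofReal (4 * d * (b - a + 4)) else 0) := by
        refine Finset.sum_le_sum fun q hq => ?_
        rw [Finset.mem_Icc] at hq
        refine hf.volume_nearRational_denom_le hab hd0 hd1 ha hb hL he hq.1
          (lt_of_le_of_lt ?_ hε)
        have : (q : ℝ) ≤ Q := le_trans (by exact_mod_cast hq.2) (Nat.floor_le hQ)
        gcongr
    _ = ENNReal.ofReal (⌊Q⌋₊ * (4 * d * (b - a + 4) / L) +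
        ((Finset.Icc 1 ⌊Q⌋₊).filter fun q : ℕ => (q : ℝ) < M * L ^ 3).card *
          (4 * d * (b - a + 4))) := by
        rw [Finset.sum_add_distrib, ← Finset.sum_filter, Finset.sum_const, Finset.sum_const,
          Nat.card_Icc, Nat.add_sub_cancel, nsmul_eq_mul, nsmul_eq_mul,
          ENNReal.ofReal_add (by positivity) (by positivity),
          ENNReal.ofReal_mul (p := (⌊Q⌋₊ : ℝ)) (by positivity),
          ENNReal.ofReal_mul (p := (Finset.card _ : ℝ)) (by positivity), ENNReal.ofReal_natCast,
          ENNReal.ofReal_natCast]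
    _ ≤ _ := by
        apply ENNReal.ofReal_le_ofReal
        have h1 := Nat.floor_le hQ
        calc _ ≤ Q * (4 * d * (b - a + 4) / L) + M * L ^ 3 * (4 * d * (b - a + 4)) := by gcongr
          _ = _ := by ring

end ConvexArc

theorem one_div_floor_le {y : ℝ} (hy : 1 ≤ y) : 1 / (⌊y⌋₊ : ℝ) ≤ 2 / y := by
  have h1 : 1 ≤ ⌊y⌋₊ := Nat.one_le_floor_iff y |>.2 hy
  have h2 : (1 : ℝ) ≤ ⌊y⌋₊ := by exact_mod_cast h1
  have h3 := Nat.lt_floor_add_one y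
  rw [div_le_div_iff₀ (by linarith) (by linarith)]
  linarith

theorem abs_fract_sub_fract_le {m : ℕ} (hm : 0 < m) {u v : ℝ}
    (h : ⌊m * Int.fract u⌋₊ = ⌊m * Int.fract v⌋₊) : |Int.fract u - Int.fract v| ≤ 1 / m := by
  have hm' : (0 : ℝ) < m := by exact_mod_cast hm
  have hu : 0 ≤ m * Int.fract u := mul_nonneg hm'.le (Int.fract_nonneg u)
  have hv : 0 ≤ m * Int.fract v := mul_nonneg hm'.le (Int.fract_nonneg v)
  have h1 := Nat.floor_le hu
  have h2 := Nat.lt_floor_add_one (m * Int.fract u)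
  have h3 := Nat.floor_le hv
  have h4 := Nat.lt_floor_add_one (m * Int.fract v)
  rw [h] at h1 h2
  rw [show Int.fract u - Int.fract v = (m * Int.fract u - m * Int.fract v) / m by field_simp,
    abs_div, abs_of_pos hm']
  gcongr
  rw [abs_le]
  constructor <;> linarith

/-- A form of Dirichlet's theorem, adapted to the tangent direction at `x`. -/
theorem mem_nearRationalSet (f f₁ : ℝ → ℝ) {Q : ℕ} {δ : ℝ} (hδ0 : 0 < δ) (hδ1 : δ ≤ 1)
    (hQ : 1 ≤ Q * δ) (x : ℝ) : x ∈ nearRationalSet f f₁ Q (2 / (Q * δ)) (2 * δ) := by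
  set m₁ := ⌊Q * δ⌋₊ with hm₁
  set m₂ := ⌊1 / δ⌋₊ with hm₂
  have hδ' : 1 ≤ 1 / δ := by rwa [le_div_iff₀ hδ0, one_mul]
  have hm₁0 : 0 < m₁ := Nat.floor_pos.2 hQ
  have hm₂0 : 0 < m₂ := Nat.floor_pos.2 hδ'
  have hprod : m₁ * m₂ ≤ Q := by
    have h1 : (m₁ : ℝ) ≤ Q * δ := Nat.floor_le (by linarith)
    have h2 : (m₂ : ℝ) ≤ 1 / δ := Nat.floor_le (by linarith)
    have h3 : (m₁ : ℝ) * m₂ ≤ Q * δ * (1 / δ) := by gcongr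
    rw [show Q * δ * (1 / δ) = (Q : ℝ) by field_simp] at h3
    exact_mod_cast h3
  let β : ℕ → ℝ := fun q => q * f x - f₁ x * Int.fract (q * x)
  let F : ℕ → ℕ × ℕ := fun q => (⌊m₁ * Int.fract (q * x)⌋₊, ⌊m₂ * Int.fract (β q)⌋₊)
  have hbox : ∀ m : ℕ, 0 < m → ∀ u : ℝ, ⌊m * Int.fract u⌋₊ < m := fun m hm u => by
    have hm' : (0 : ℝ) < m := by exact_mod_cast hm
    rw [Nat.floor_lt (mul_nonneg hm'.le (Int.fract_nonneg u))]
    exact mul_lt_of_lt_one_right hm' (Int.fract_lt_one u)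
  have hpig : ∃ q ∈ Finset.range (Q + 1), ∃ q' ∈ Finset.range (Q + 1), q ≠ q' ∧ F q = F q' := by
    apply Finset.exists_ne_map_eq_of_card_lt_of_maps_to
      (t := Finset.range m₁ ×ˢ Finset.range m₂)
    · rw [Finset.card_product, Finset.card_range, Finset.card_range, Finset.card_range]
      omega
    · intro q _
      rw [Finset.mem_coe, Finset.mem_product, Finset.mem_range, Finset.mem_range]
      exact ⟨hbox _ hm₁0 _, hbox _ hm₂0 _⟩
  have key : ∃ q q' : ℕ, q < q' ∧ q' ≤ Q ∧ F q' = F q := by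
    obtain ⟨q, hq, q', hq', hne, hF⟩ := hpig
    rw [Finset.mem_range] at hq hq'
    rcases lt_or_gt_of_ne hne with h | h
    · exact ⟨q, q', h, by omega, hF.symm⟩
    · exact ⟨q', q, h, by omega, hF⟩
  obtain ⟨q, q', hlt, hle, hF⟩ := key
  have hF1 := abs_fract_sub_fract_le hm₁0 (congrArg Prod.fst hF)
  have hF2 := abs_fract_sub_fract_le hm₂0 (congrArg Prod.snd hF)
  have hD : ((q' - q : ℤ) : ℝ) * x - ((⌊(q' : ℝ) * x⌋ - ⌊(q : ℝ) * x⌋ : ℤ) : ℝ) =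
      Int.fract (q' * x) - Int.fract (q * x) := by
    unfold Int.fract; push_cast; ring
  refine ⟨q' - q, ⌊(q' : ℝ) * x⌋ - ⌊(q : ℝ) * x⌋, ⌊β q'⌋ - ⌊β q⌋, by omega, ?_, ?_, ?_⟩
  · have : (q' : ℤ) - q ≤ Q := by omega
    exact_mod_cast this
  · rw [hD]
    exact hF1.trans (one_div_floor_le hQ)
  · have hh : tangentForm f f₁ (q' - q) (⌊(q' : ℝ) * x⌋ - ⌊(q : ℝ) * x⌋) (⌊β q'⌋ - ⌊β q⌋) x =
        Int.fract (β q') - Int.fract (β q) := by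
      unfold tangentForm
      rw [hD]
      simp only [Int.fract, β]; push_cast; ring
    rw [hh]
    refine hF2.trans ((one_div_floor_le hδ').trans (le_of_eq ?_))
    field_simp

namespace ConvexArc

variable {f f₁ : ℝ → ℝ} {A B c M : ℝ}

theorem volume_nearRational_diff_le (hf : ConvexArc f f₁ A B c M) {a b κ Q δ : ℝ}
    (hab : Set.Icc a b ⊆ Set.Icc A B) (hQ : 200 < Q) (hδ0 : 0 < δ)
    (hQδ : 3360 * M ≤ Q ^ 2 * δ ^ 3) :
    volume ((Set.Icc a b ∩ nearRationalSet f f₁ (κ * Q) (2 / (Q * δ)) (2 * δ)) \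
        resonantSet f f₁ (100 * κ / δ) (5 * κ * Q * δ) (200 / Q)) ≤
      ENNReal.ofReal (1 / 8 * (b - a + 2 * (16 / (Q * δ)))) := by
  have hM := hf.one_le
  have hQ0 : 0 < Q := by linarith
  set E := (Set.Icc a b ∩ nearRationalSet f f₁ (κ * Q) (2 / (Q * δ)) (2 * δ)) \
        resonantSet f f₁ (100 * κ / δ) (5 * κ * Q * δ) (200 / Q) with hE
  let W : ℝ → ℤ × ℤ × ℤ → Prop := fun x v => 1 ≤ v.1 ∧ (v.1 : ℝ) ≤ κ * Q ∧
    |v.1 * x - v.2.1| ≤ 2 / (Q * δ) ∧ |tangentForm f f₁ v.1 v.2.1 v.2.2 x| ≤ 2 * δ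
  have hrad : ∀ x ∈ E, ∃ r, 0 < r ∧ r ≤ 16 / (Q * δ) ∧
      volume (E ∩ Metric.closedBall x (5 * r)) ≤ ENNReal.ofReal (1 / 8 * (2 * r)) := by
    intro x hx
    obtain ⟨⟨hxab, hxW⟩, -⟩ := hx
    obtain ⟨⟨q, p, s⟩, ⟨h0, h1, h2, h3⟩, hmin⟩ : ∃ v, W x v ∧ ∀ w, W x w →
        v.1.natAbs ≤ w.1.natAbs := by
      obtain ⟨q, p, s, h⟩ := hxW
      exact exists_forall_le_of_nat (fun v : ℤ × ℤ × ℤ => v.1.natAbs) ⟨(q, p, s), h⟩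
    simp only at h0 h1 h2 h3 hmin
    have hq1 : (1 : ℝ) ≤ q := by exact_mod_cast h0
    have hq0 : (0 : ℝ) < q := by linarith
    have hκ : 0 < κ * Q := by linarith
    have hκ0 : 0 < κ := pos_of_mul_pos_left hκ hQ0.le
    set r := 16 / (q * (Q * δ)) with hr
    have hr0 : 0 < r := by positivity
    have hqr : q * r = 16 / (Q * δ) := by rw [hr]; field_simp
    refine ⟨r, hr0, ?_, ?_⟩
    · rw [← hqr]; nlinarith
    calc volume (E ∩ Metric.closedBall x (5 * r))
        ≤ volume (Metric.closedBall ((p : ℝ) / q) (r / 8)) := ?_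
      _ = _ := by rw [Real.volume_closedBall]; congr 1; ring
    refine measure_mono ?_
    rintro y ⟨⟨⟨hyab, q', p', s', k0, k1, k2, k3⟩, hyR⟩, hyx⟩
    rw [Metric.mem_closedBall, Real.dist_eq] at hyx
    have hq'1 : (1 : ℝ) ≤ q' := by exact_mod_cast k0
    have hq'0 : (0 : ℝ) < q' := by linarith
    have hDy : |q * y - p| ≤ 82 / (Q * δ) := by
      have e1 : (q : ℝ) * y - p = (q * x - p) + q * (y - x) := by ring
      rw [e1]
      refine (abs_add_le _ _).trans ?_
      rw [abs_mul, abs_of_pos hq0]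
      have e2 : (q : ℝ) * |y - x| ≤ q * (5 * r) := by gcongr
      have e3 : q * (5 * r) = 80 / (Q * δ) := by
        rw [show (q : ℝ) * (5 * r) = 5 * (q * r) by ring, hqr]; ring
      have e4 : 82 / (Q * δ) = 2 / (Q * δ) + 80 / (Q * δ) := by ring
      linarith
    have hhy : |tangentForm f f₁ q p s y| ≤ 3 * δ := by
      have e1 := hf.abs_tangentForm_sub_le (hab hyab) (hab hxab) q p s
      rw [abs_sub_comm, abs_sub_comm x y, sub_sq_comm] at e1
      have e2 := abs_sub_abs_le_abs_sub (tangentForm f f₁ q p s y) (tangentForm f f₁ q p s x)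
      have e3 : |(q : ℝ)| * (M / 2 * (y - x) ^ 2) + M * |y - x| * |q * x - p| ≤ δ := by
        rw [abs_of_pos hq0, ← sq_abs]
        calc (q : ℝ) * (M / 2 * |y - x| ^ 2) + M * |y - x| * |q * x - p| ≤
              q * (M / 2 * (5 * r) ^ 2) + M * (5 * r) * (2 / (Q * δ)) := by gcongr
          _ = 3360 * M / (q * (Q * δ) ^ 2) := by rw [hr]; field_simp; ring
          _ ≤ Q ^ 2 * δ ^ 3 / (1 * (Q * δ) ^ 2) := by gcongr
          _ = δ := by field_simp
      linarith
    have hcross : p * s' - s * p' = 0 ∧ s * q' - q * s' = 0 ∧ q * p' - p * q' = 0 := by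
      by_contra hcon
      have l0 : |(p * s' - s * p' : ℝ) + (s * q' - q * s') * y + (q * p' - p * q') * f y| ≤
          200 / Q := by
        have e1 : (p * s' - s * p' : ℝ) + (s * q' - q * s') * y + (q * p' - p * q') * f y =
            (q * y - p) * tangentForm f f₁ q' p' s' y -
              tangentForm f f₁ q p s y * (q' * y - p') := by
          unfold tangentForm; ring
        rw [e1]
        refine (abs_sub _ _).trans ?_
        rw [abs_mul, abs_mul]
        calc _ ≤ 82 / (Q * δ) * (2 * δ) + 3 * δ * (2 / (Q * δ)) := by gcongr
          _ = 170 / Q := by field_simp; ring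
          _ ≤ 200 / Q := by gcongr; norm_num
      have l1 : |(s * q' - q * s' : ℝ) + (q * p' - p * q') * f₁ y| ≤ 5 * κ * Q * δ := by
        have e1 : (s * q' - q * s' : ℝ) + (q * p' - p * q') * f₁ y =
            q * tangentForm f f₁ q' p' s' y - tangentForm f f₁ q p s y * q' := by
          unfold tangentForm; ring
        rw [← abs_neg] at hhy
        rw [e1]
        refine (abs_sub _ _).trans ?_
        rw [abs_mul, abs_mul, abs_of_pos hq0, abs_of_pos hq'0]
        rw [abs_neg] at hhy
        calc _ ≤ κ * Q * (2 * δ) + 3 * δ * (κ * Q) := by gcongr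
          _ = _ := by ring
      have l2 : |(q * p' - p * q' : ℝ)| ≤ 100 * κ / δ := by
        have e1 : (q * p' - p * q' : ℝ) = (q * y - p) * q' - q * (q' * y - p') := by ring
        rw [e1]
        refine (abs_sub _ _).trans ?_
        rw [abs_mul, abs_mul, abs_of_pos hq0, abs_of_pos hq'0]
        calc _ ≤ 82 / (Q * δ) * (κ * Q) + κ * Q * (2 / (Q * δ)) := by gcongr
          _ = 84 * κ / δ := by field_simp; ring
          _ ≤ _ := by gcongr; norm_num
      have hne : s * q' - q * s' ≠ 0 ∨ q * p' - p * q' ≠ 0 := by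
        by_contra! h
        have h1 : (s * q' - q * s' : ℝ) = 0 := by exact_mod_cast h.1
        have h2 : (q * p' - p * q' : ℝ) = 0 := by exact_mod_cast h.2
        rw [h1, h2, zero_mul, zero_mul, add_zero, add_zero] at l0
        have h3 : |(p * s' - s * p' : ℝ)| < 1 :=
          l0.trans_lt (by rw [div_lt_one hQ0]; exact hQ)
        have h4 : p * s' - s * p' = 0 := Int.abs_lt_one_iff.1 (by exact_mod_cast h3)
        exact hcon ⟨h4, h.1, h.2⟩
      refine hyR ⟨p * s' - s * p', s * q' - q * s', q * p' - p * q', hne, ?_, ?_, ?_⟩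
      · push_cast; exact l2
      · push_cast; exact l1
      · push_cast; exact l0
    obtain ⟨l, lq, lp, ls⟩ := exists_eq_mul_of_cross_eq_zero (a₀ := (q : ℝ)) (a₁ := p)
      (a₂ := s) (b₀ := q') (b₁ := p') (b₂ := s') (Or.inl hq0.ne') (by exact_mod_cast hcross.1)
      (by exact_mod_cast hcross.2.1) (by exact_mod_cast hcross.2.2)
    have hl0 : 0 < l := pos_of_mul_pos_left (lq ▸ hq'0) hq0.le
    have hl : 1 ≤ l := by
      by_contra! hl
      have hmul : ∀ t : ℝ, |l * t| ≤ |t| := fun t => by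
        rw [abs_mul, abs_of_pos hl0]; nlinarith [abs_nonneg t]
      have := hmin (q', p', s') ⟨k0, k1, ?_, ?_⟩
      · have h5 : q ≤ q' := by simp only at this; omega
        have h6 : (q : ℝ) ≤ q' := by exact_mod_cast h5
        nlinarith
      · simp only
        rw [lq, lp, mul_assoc, ← mul_sub]
        exact (hmul _).trans h2
      · simp only
        have : tangentForm f f₁ q' p' s' x = l * tangentForm f f₁ q p s x := by
          unfold tangentForm; rw [lq, lp, ls]; ring
        rw [this]
        exact (hmul _).trans h3
    rw [lq, lp, mul_assoc, ← mul_sub, abs_mul, abs_of_pos hl0] at k2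
    have h7 : |q * y - p| ≤ 2 / (Q * δ) := (le_mul_of_one_le_left (abs_nonneg _) hl).trans k2
    rw [Metric.mem_closedBall, Real.dist_eq,
      show y - (p : ℝ) / q = (q * y - p) / q by field_simp, abs_div, abs_of_pos hq0,
      div_le_iff₀ hq0]
    linarith [show r / 8 * q = 2 / (Q * δ) by
      rw [show r / 8 * (q : ℝ) = (q * r) / 8 by ring, hqr]; ring]
  choose! r hr0 hrg hr using hrad
  exact volume_le_of_local_density (by norm_num) (fun x hx => hx.1.1) hr0 hrg hr

end ConvexArc

theorem nearRationalSet_mono {f f₁ : ℝ → ℝ} {Q Q' d d' e e' : ℝ} (hQ : Q ≤ Q') (hd : d ≤ d')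
    (he : e ≤ e') : nearRationalSet f f₁ Q d e ⊆ nearRationalSet f f₁ Q' d' e' := by
  rintro x ⟨q, p, s, h, h1, h2, h3⟩
  exact ⟨q, p, s, h, h1.trans hQ, h2.trans hd, h3.trans he⟩

namespace ConvexArc

variable {f f₁ : ℝ → ℝ} {A B c M : ℝ}

theorem volume_resonant_le_of_pow_le_deriv (hf : ConvexArc f f₁ A B c M) {a b X δ : ℝ}
    (hab : Set.Icc a b ⊆ Set.Icc A B) (hab' : a ≤ b) (hX : 20000 ≤ X) (hMX : M ≤ X)
    (hδ : δ * X ^ 50 ≤ 1) (hδ' : 1 ≤ δ * X ^ 51) :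
    volume {x | x ∈ Set.Icc a b ∧ ∃ a₀ a₁ a₂ : ℤ, |(a₂ : ℝ)| ≤ 1 / (100 * δ) ∧
      X ^ 4 ≤ |a₁ + a₂ * f₁ x| ∧ |a₁ + a₂ * f₁ x| ≤ X ^ 100 * δ / 2000 ∧
      |a₀ + a₁ * x + a₂ * f x| ≤ 200 / X ^ 100} ≤
      ENNReal.ofReal ((b - a) / 8 + 800 / X) := by
  have hM := hf.one_le
  have hX0 : 0 < X := by linarith
  have hX1 : 1 ≤ X := by linarith
  have hδ0 : 0 < δ := pos_of_mul_pos_left (by linarith) (by positivity : 0 ≤ X ^ 51)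
  set N := ⌊1 / (100 * δ)⌋₊ with hN
  have hNle : (N : ℝ) ≤ 1 / (100 * δ) := Nat.floor_le (by positivity)
  set D := X ^ 100 * δ / 2000 with hD
  have hD0 : 0 ≤ D := by positivity
  have hX50 : 20000 ≤ X ^ 50 := hX.trans (le_self_pow₀ hX1 (by norm_num))
  have hX49 : 20000 ≤ X ^ 49 := hX.trans (le_self_pow₀ hX1 (by norm_num))
  have hδs : δ ≤ 1 / 20000 := by nlinarith
  have hN1 : (2 * N + 1 : ℝ) ≤ 21 / (1000 * δ) := by
    have : 1 ≤ 1 / (1000 * δ) := by rw [le_div_iff₀ (by positivity)]; linarith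
    calc (2 * N + 1 : ℝ) ≤ 2 * (1 / (100 * δ)) + 1 / (1000 * δ) := by linarith
      _ = _ := by field_simp; norm_num
  have hD1 : 2 * D + 1 ≤ 11 / 10000 * (X ^ 100 * δ) := by
    have : X ^ 100 * δ = X ^ 49 * (δ * X ^ 51) := by ring
    have : 20000 * 1 ≤ X ^ 49 * (δ * X ^ 51) := by gcongr
    rw [hD]; linarith
  have hN2 : (2 * N + 1 : ℝ) ≤ X ^ 51 := by
    refine hN1.trans ?_
    rw [div_le_iff₀ (by positivity)]
    linarith
  have hDX : D ≤ X ^ 50 / 2000 := by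
    rw [hD, show X ^ 100 * δ = X ^ 50 * (δ * X ^ 50) by ring]
    gcongr
    exact mul_le_of_le_one_right (by positivity) hδ
  have hN₁ : (2 * (⌈D + M * N⌉₊ : ℝ) + 1) ≤ X ^ 52 := by
    have h1 := Nat.ceil_lt_add_one (show 0 ≤ D + M * N by positivity)
    have h2 : M * N ≤ X * (X ^ 51 / 4) := by
      gcongr
      refine hNle.trans ?_
      rw [div_le_iff₀ (by positivity)]
      linarith
    have h3 : X ^ 50 * 20000 ≤ X ^ 50 * (X * X) := by gcongr; nlinarith
    have h4 : X ^ 50 * (X * X) = X ^ 52 := by ring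
    have h5 : X * (X ^ 51 / 4) = X ^ 52 / 4 := by ring
    linarith
  have hη : 200 / X ^ 100 ≤ 1 / 4 := by
    rw [div_le_div_iff₀ (by positivity) (by norm_num)]
    linarith [hX.trans (le_self_pow₀ hX1 (by norm_num : 100 ≠ 0))]
  have key := hf.volume_resonant_le_of_le_deriv hab hab' (K := X ^ 4) (D := D)
    (η := 200 / X ^ 100) (by positivity) hD0 (by positivity) hη (N := N) (N₁ := ⌈D + M * N⌉₊)
    (Nat.le_ceil _)
  refine (measure_mono ?_).trans (key.trans (ENNReal.ofReal_le_ofReal ?_))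
  · rintro x ⟨hx, a₀, a₁, a₂, h1, h2, h3, h4⟩
    refine ⟨hx, a₀, a₁, a₂, ?_, h2, h3, h4⟩
    have : a₂.natAbs ≤ N := Nat.le_floor (by rwa [Nat.cast_natAbs, Int.cast_abs])
    rw [← Int.cast_abs, ← Nat.cast_natAbs]
    exact_mod_cast this
  · have hba : 0 ≤ b - a := by linarith
    rw [mul_add]
    have e1 : (2 * N + 1 : ℝ) * ((2 * (⌈D + M * N⌉₊ : ℝ) + 1) * (4 * (200 / X ^ 100) / X ^ 4)) ≤
        X ^ 51 * (X ^ 52 * (4 * (200 / X ^ 100) / X ^ 4)) := by gcongr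
    have e2 : X ^ 51 * (X ^ 52 * (4 * (200 / X ^ 100) / X ^ 4)) = 800 / X := by
      field_simp; norm_num
    have e3 : (2 * N + 1 : ℝ) * (16 * (200 / X ^ 100) * ((2 * D + 1) * (b - a))) ≤
        21 / (1000 * δ) * (16 * (200 / X ^ 100) * ((11 / 10000 * (X ^ 100 * δ)) * (b - a))) := by
      gcongr
    have e4 : 21 / (1000 * δ) * (16 * (200 / X ^ 100) * ((11 / 10000 * (X ^ 100 * δ)) * (b - a)))
        = 21 * 16 * 200 * 11 / 10000000 * (b - a) := by field_simp; ring
    linarith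

theorem volume_resonant_flat_le (hf : ConvexArc f f₁ A B c M) {a b X : ℝ} (hab : a ≤ b)
    (hX : 20000 * M ≤ X) (hc : 1 < X * c) (ha : 1 ≤ (a - A) * X) (hb : 1 ≤ (B - b) * X) :
    volume (Set.Icc a b ∩ resonantSet f f₁ (X ^ 51) (X ^ 4) (200 / X ^ 100)) ≤
      ENNReal.ofReal (((60 * M / √c + 8) / 2 * (b - a + 2) + 8 * (b - a + 4)) / X) := by
  have hM := hf.one_le
  have hX' : 20000 ≤ X := by linarith
  have hX0 : 0 < X := by linarith
  have hX1 : 1 ≤ X := by linarith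
  have hpow : ∀ {m n : ℕ}, m ≤ n → X ^ m ≤ X ^ n := fun h => pow_le_pow_right₀ hX1 h
  set η := 200 / X ^ 100 with hη
  have hs : √η ≤ 15 / X ^ 50 := by
    rw [Real.sqrt_le_left (by positivity), hη, div_pow, ← pow_mul]
    gcongr; norm_num
  have hr : 5 * (X * √η) ≤ 1 / X := by
    calc 5 * (X * √η) ≤ 5 * (X * (15 / X ^ 50)) := by gcongr
      _ = 75 / X ^ 48 * (1 / X) := by field_simp; norm_num
      _ ≤ 1 * (1 / X) := by
        gcongr
        rw [div_le_one (by positivity)]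
        linarith [hX'.trans (le_self_pow₀ hX1 (by norm_num : 48 ≠ 0))]
      _ = _ := one_mul _
  have hXinv : 1 / X ≤ 1 := by rw [div_le_one hX0]; exact hX1
  have ha' : 1 / X ≤ a - A := by rwa [div_le_iff₀ hX0]
  have hb' : 1 / X ≤ B - b := by rwa [div_le_iff₀ hX0]
  have hη' : 20 * M * (X ^ 2 * η) ≤ 1 / X ^ 97 := by
    calc 20 * M * (X ^ 2 * η) = 4000 * M / X * (1 / X ^ 97) := by rw [hη]; field_simp; norm_num
      _ ≤ 1 * (1 / X ^ 97) := by
        gcongr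
        rw [div_le_one hX0]; linarith
      _ = _ := one_mul _
  have hη'0 : 0 ≤ 20 * M * (X ^ 2 * η) := by positivity
  have hg : X ^ 2 * η ≤ 1 := by
    have : X ^ 2 * η ≤ 20 * M * (X ^ 2 * η) :=
      le_mul_of_one_le_left (by positivity) (by linarith)
    refine this.trans (hη'.trans ?_)
    rw [div_le_one (by positivity)]
    exact one_le_pow₀ hX1
  have hd : 2 * X ^ 51 * (20 * M * (X ^ 2 * η)) ≤ 1 / X ^ 45 := by
    calc 2 * X ^ 51 * (20 * M * (X ^ 2 * η)) ≤ 2 * X ^ 51 * (1 / X ^ 97) := by gcongr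
      _ = 2 / X * (1 / X ^ 45) := by field_simp
      _ ≤ 1 * (1 / X ^ 45) := by
        gcongr
        rw [div_le_one hX0]; linarith
      _ = _ := one_mul _
  have he : 2 * X ^ 5 * (20 * M * (X ^ 2 * η)) ≤ 1 / X ^ 91 := by
    calc 2 * X ^ 5 * (20 * M * (X ^ 2 * η)) ≤ 2 * X ^ 5 * (1 / X ^ 97) := by gcongr
      _ = 2 / X * (1 / X ^ 91) := by field_simp
      _ ≤ 1 * (1 / X ^ 91) := by
        gcongr
        rw [div_le_one hX0]; linarith
      _ = _ := one_mul _
  have hd45 : 1 / X ^ 45 ≤ 1 / X := by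
    gcongr
    exact le_self_pow₀ hX1 (by norm_num)
  have he91 : 1 / X ^ 91 ≤ 1 / X := by
    gcongr
    exact le_self_pow₀ hX1 (by norm_num)
  have hX2 : 1 / X < 1 := by rw [div_lt_one hX0]; linarith
  have h1 := hf.volume_resonant_diff_le (a := a) (b := b) (g := X) (η := η) (N := X ^ 51)
    (K := X ^ 4) (K' := X ^ 5) hX1 (by positivity) hg (by linarith) (by linarith)
    (by positivity) (by
      calc X ^ 4 + X ^ 51 * (M * (5 * (X * √η)))
          ≤ X ^ 4 + X ^ 51 * (M * (5 * (X * (15 / X ^ 50)))) := by gcongr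
        _ = X ^ 4 + 75 * M * X ^ 2 := by field_simp; ring
        _ ≤ X ^ 4 + X * X ^ 2 := by gcongr; linarith
        _ ≤ X ^ 4 + X * X ^ 3 := by gcongr _ + _ * ?_; exact hpow (by norm_num)
        _ = 2 * X ^ 4 := by ring
        _ ≤ X * X ^ 4 := by gcongr; linarith
        _ = X ^ 5 := by ring)
  have h2 := doublyResonantSet_subset (f := f) (f₁ := f₁) (N := X ^ 51) (K := X ^ 5)
    (η := 20 * M * (X ^ 2 * η)) (by linarith) (by linarith)
  have hQ' : 2 * X ^ 51 * X ^ 5 ≤ X ^ 57 := by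
    calc 2 * X ^ 51 * X ^ 5 = 2 * X ^ 56 := by ring
      _ ≤ X * X ^ 56 := by gcongr; linarith
      _ = _ := by ring
  have h3 := h2.trans (nearRationalSet_mono hQ' hd he)
  have hL1 : X ^ 13 ≤ (⌈X ^ 13⌉ : ℝ) := Int.le_ceil _
  have hL2 : (⌈X ^ 13⌉ : ℝ) ≤ X ^ 14 := by
    have e1 := Int.ceil_lt_add_one (X ^ 13)
    have e2 : 1 ≤ X ^ 13 := one_le_pow₀ hX1
    have e3 : 2 * X ^ 13 ≤ X * X ^ 13 := by gcongr; linarith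
    have e4 : X * X ^ 13 = X ^ 14 := by ring
    linarith
  have hLpos : 0 < ⌈X ^ 13⌉ := Int.ceil_pos.2 (by positivity)
  have hLpos' : (0 : ℝ) < ⌈X ^ 13⌉ := by exact_mod_cast hLpos
  have h4 := hf.volume_nearRational_le (a := a) (b := b) (Q := X ^ 57) (d := 1 / X ^ 45)
    (e := 1 / X ^ 91) (ε := 1 / X ^ 88) (L := ⌈X ^ 13⌉) hab (by positivity) (by linarith)
    (by linarith) (by linarith) hLpos (by positivity) (by
      calc 1 / X ^ 91 + M * (1 / X ^ 45) ^ 2 ≤ 1 / X ^ 90 + M * (1 / X ^ 45) ^ 2 := by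
            gcongr ?_ + _
            exact one_div_le_one_div_of_le (by positivity) (hpow (by norm_num))
        _ = (1 + M) / X ^ 2 * (1 / X ^ 88) := by field_simp
        _ ≤ 1 * (1 / X ^ 88) := by
            gcongr
            rw [div_le_one (by positivity)]
            nlinarith
        _ = _ := one_mul _)
    (by positivity)
    (by
      calc 2 * (⌈X ^ 13⌉ : ℝ) * (1 / X ^ 88) * X ^ 57 ≤ 2 * X ^ 14 * (1 / X ^ 88) * X ^ 57 := by
            gcongr
        _ = 2 / X ^ 16 * (1 / X) := by field_simp
        _ ≤ 1 * (1 / X) := by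
            gcongr
            rw [div_le_one (by positivity)]
            linarith [hX'.trans (le_self_pow₀ hX1 (by norm_num : 16 ≠ 0))]
        _ < c := by rw [one_mul, div_lt_iff₀ hX0]; linarith)
  have hba : 0 ≤ b - a := by linarith
  have hsub : Set.Icc a b ∩ resonantSet f f₁ (X ^ 51) (X ^ 4) η ⊆
      ((Set.Icc a b ∩ resonantSet f f₁ (X ^ 51) (X ^ 4) η) \
        doublyResonantSet f f₁ (X ^ 51) (X ^ 5) (20 * M * (X ^ 2 * η))) ∪
      (Set.Icc a b ∩ nearRationalSet f f₁ (X ^ 57) (1 / X ^ 45) (1 / X ^ 91)) := by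
    intro x hx
    by_cases hx' : x ∈ doublyResonantSet f f₁ (X ^ 51) (X ^ 5) (20 * M * (X ^ 2 * η))
    · exact Or.inr ⟨hx.1, h3 hx'⟩
    · exact Or.inl ⟨hx, hx'⟩
  refine (measure_mono hsub).trans ((measure_union_le _ _).trans ((add_le_add h1 h4).trans ?_))
  rw [← ENNReal.ofReal_add (by positivity) (by positivity)]
  apply ENNReal.ofReal_le_ofReal
  have f1 : (60 * M / √c + 8) / X / 2 * (b - a + 2 * (X * √η)) ≤
      (60 * M / √c + 8) / 2 * (b - a + 2) / X := by
    calc _ ≤ (60 * M / √c + 8) / X / 2 * (b - a + 2) := by gcongr; linarith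
      _ = _ := by ring
  have f2 : 4 * (1 / X ^ 45) * (b - a + 4) * (M * (⌈X ^ 13⌉ : ℝ) ^ 3 + X ^ 57 / ⌈X ^ 13⌉) ≤
      8 * (b - a + 4) / X := by
    calc _ ≤ 4 * (1 / X ^ 45) * (b - a + 4) * (X * (X ^ 14) ^ 3 + X ^ 57 / X ^ 13) := by
          gcongr; linarith
      _ ≤ 4 * (1 / X ^ 45) * (b - a + 4) * (X ^ 44 + X ^ 44) := by
          gcongr
          · calc X * (X ^ 14) ^ 3 = X ^ 43 := by ring
              _ ≤ _ := hpow (by norm_num)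
          · rw [div_le_iff₀ (by positivity), ← pow_add]
      _ = _ := by field_simp; norm_num
  exact (add_le_add f1 f2).trans_eq (add_div _ _ _).symm

theorem volume_nearRational_denom_le_half (hf : ConvexArc f f₁ A B c M) {a b X δ : ℝ}
    (hab : a ≤ b) (hX : 20000 * M ≤ X) (hc : 1 < X * c) (ha : 1 ≤ (a - A) * X)
    (hb : 1 ≤ (B - b) * X)
    (hX' : 804 + (60 * M / √c + 8) / 2 * (b - a + 2) + 8 * (b - a + 4) ≤ (b - a) / 8 * X)
    (hδ : δ * X ^ 50 ≤ 1) (hδ' : 1 ≤ δ * X ^ 51) :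
    volume (Set.Icc a b ∩
      nearRationalSet f f₁ (1 / 10000 * X ^ 100) (2 / (X ^ 100 * δ)) (2 * δ)) ≤
      ENNReal.ofReal ((b - a) / 2) := by
  have hM := hf.one_le
  have hX2 : 20000 ≤ X := by linarith
  have hX0 : 0 < X := by linarith
  have hX1 : 1 ≤ X := by linarith
  have hδ0 : 0 < δ := pos_of_mul_pos_left (by linarith) (by positivity : 0 ≤ X ^ 51)
  have hba : 0 ≤ b - a := by linarith
  have hsub : Set.Icc a b ⊆ Set.Icc A B := Set.Icc_subset_Icc
    (by linarith [pos_of_mul_pos_left (show 0 < (a - A) * X by linarith) hX0.le])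
    (by linarith [pos_of_mul_pos_left (show 0 < (B - b) * X by linarith) hX0.le])
  have hQ : 200 < X ^ 100 := by
    linarith [hX2.trans (le_self_pow₀ hX1 (by norm_num : 100 ≠ 0))]
  have hQδ : 3360 * M ≤ (X ^ 100) ^ 2 * δ ^ 3 := by
    calc 3360 * M ≤ X ^ 1 := by linarith
      _ ≤ X ^ 47 := pow_le_pow_right₀ hX1 (by norm_num)
      _ ≤ X ^ 47 * (δ * X ^ 51) ^ 3 :=
        le_mul_of_one_le_right (by positivity) (one_le_pow₀ hδ')
      _ = _ := by ring
  have h1 := hf.volume_nearRational_diff_le (κ := 1 / 10000) hsub hQ hδ0 hQδ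
  have h2 := hf.volume_resonant_le_of_pow_le_deriv hsub hab hX2 (by linarith) hδ hδ'
  have h3 := hf.volume_resonant_flat_le hab hX hc ha hb
  rw [show 100 * (1 / 10000) / δ = 1 / (100 * δ) by field_simp; norm_num,
    show 5 * (1 / 10000) * X ^ 100 * δ = X ^ 100 * δ / 2000 by ring] at h1
  have hN : 1 / (100 * δ) ≤ X ^ 51 := by
    rw [div_le_iff₀ (by positivity)]
    linarith
  have hcover : Set.Icc a b ∩
        nearRationalSet f f₁ (1 / 10000 * X ^ 100) (2 / (X ^ 100 * δ)) (2 * δ) ⊆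
      ((Set.Icc a b ∩
        nearRationalSet f f₁ (1 / 10000 * X ^ 100) (2 / (X ^ 100 * δ)) (2 * δ)) \
        resonantSet f f₁ (1 / (100 * δ)) (X ^ 100 * δ / 2000) (200 / X ^ 100)) ∪
      ({x | x ∈ Set.Icc a b ∧ ∃ a₀ a₁ a₂ : ℤ, |(a₂ : ℝ)| ≤ 1 / (100 * δ) ∧
      X ^ 4 ≤ |a₁ + a₂ * f₁ x| ∧ |a₁ + a₂ * f₁ x| ≤ X ^ 100 * δ / 2000 ∧
      |a₀ + a₁ * x + a₂ * f x| ≤ 200 / X ^ 100} ∪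
      (Set.Icc a b ∩ resonantSet f f₁ (X ^ 51) (X ^ 4) (200 / X ^ 100))) := by
    intro x hx
    by_cases hx' : x ∈ resonantSet f f₁ (1 / (100 * δ)) (X ^ 100 * δ / 2000) (200 / X ^ 100)
    · obtain ⟨a₀, a₁, a₂, h, k1, k2, k3⟩ := hx'
      rcases le_total (X ^ 4) |a₁ + a₂ * f₁ x| with k | k
      · exact Or.inr (Or.inl ⟨hx.1, a₀, a₁, a₂, k1, k, k2, k3⟩)
      · exact Or.inr (Or.inr ⟨hx.1, a₀, a₁, a₂, h, k1.trans hN, k, k3⟩)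
    · exact Or.inl ⟨hx, hx'⟩
  refine (measure_mono hcover).trans ((measure_union_le _ _).trans ((add_le_add h1
    ((measure_union_le _ _).trans (add_le_add h2 h3))).trans ?_))
  rw [← ENNReal.ofReal_add (by positivity) (by positivity),
    ← ENNReal.ofReal_add (by positivity) (by positivity)]
  apply ENNReal.ofReal_le_ofReal
  have e1 : 16 / (X ^ 100 * δ) ≤ 16 / X := by
    gcongr
    calc X = X ^ 1 * 1 := by ring
      _ ≤ X ^ 49 * (δ * X ^ 51) := by
        gcongr
        norm_num
      _ = _ := by ring
  have e2 : (804 + (60 * M / √c + 8) / 2 * (b - a + 2) + 8 * (b - a + 4)) / X ≤ (b - a) / 8 := by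
    rwa [div_le_iff₀ hX0]
  have e3 : (804 + (60 * M / √c + 8) / 2 * (b - a + 2) + 8 * (b - a + 4)) / X =
    ((60 * M / √c + 8) / 2 * (b - a + 2) + 8 * (b - a + 4)) / X + 800 / X + 1 / 4 * (16 / X) := by
    ring
  linarith

end ConvexArc

/-- A second moment bound for the measure of a finite union. -/
theorem two_mul_sum_sub_le_measureReal_biUnion {α ι : Type*} [MeasurableSpace α] {μ : Measure α}
    (I : Finset ι) (E : ι → Set α) (hE : ∀ i ∈ I, MeasurableSet (E i))
    (hfin : ∀ i ∈ I, μ (E i) ≠ ⊤) (l : ℝ) :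
    2 * l * ∑ i ∈ I, μ.real (E i) - l ^ 2 * ∑ i ∈ I, ∑ j ∈ I, μ.real (E i ∩ E j) ≤
      μ.real (⋃ i ∈ I, E i) := by
  classical
  have hU : MeasurableSet (⋃ i ∈ I, E i) := Finset.measurableSet_biUnion I hE
  have hUfin : μ (⋃ i ∈ I, E i) ≠ ⊤ :=
    ((measure_biUnion_finset_le I E).trans_lt (ENNReal.sum_lt_top.2 fun i hi =>
      (hfin i hi).lt_top)).ne
  have hint : ∀ s : Set α, MeasurableSet s → μ s ≠ ⊤ → Integrable (s.indicator (1 : α → ℝ)) μ :=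
    fun s hs hs' => (integrable_indicator_iff hs).2 (integrableOn_const hs')
  have hint2 : ∀ i ∈ I, ∀ j ∈ I, Integrable ((E i ∩ E j).indicator (1 : α → ℝ)) μ :=
    fun i hi j hj => hint _ ((hE i hi).inter (hE j hj))
      (measure_ne_top_of_subset Set.inter_subset_left (hfin i hi))
  have hpt : ∀ x, 2 * l * ∑ i ∈ I, (E i).indicator (1 : α → ℝ) x -
      l ^ 2 * ∑ i ∈ I, ∑ j ∈ I, (E i ∩ E j).indicator (1 : α → ℝ) x ≤
      (⋃ i ∈ I, E i).indicator (1 : α → ℝ) x := by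
    intro x
    have hsq : ∑ i ∈ I, ∑ j ∈ I, (E i ∩ E j).indicator (1 : α → ℝ) x =
        (∑ i ∈ I, (E i).indicator (1 : α → ℝ) x) ^ 2 := by
      rw [sq, Finset.sum_mul_sum]
      refine Finset.sum_congr rfl fun i _ => Finset.sum_congr rfl fun j _ => ?_
      rw [Set.inter_indicator_one, Pi.mul_apply]
    rw [hsq]
    by_cases hx : x ∈ ⋃ i ∈ I, E i
    · rw [Set.indicator_of_mem hx, Pi.one_apply]
      nlinarith [sq_nonneg (l * ∑ i ∈ I, (E i).indicator (1 : α → ℝ) x - 1)]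
    · have : ∑ i ∈ I, (E i).indicator (1 : α → ℝ) x = 0 := by
        refine Finset.sum_eq_zero fun i hi => Set.indicator_of_notMem (fun hxi => hx ?_) _
        exact Set.mem_biUnion hi hxi
      rw [this, Set.indicator_of_notMem hx]
      simp
  have h1 : Integrable (fun x => 2 * l * ∑ i ∈ I, (E i).indicator (1 : α → ℝ) x) μ :=
    (integrable_finsetSum I fun i hi => hint _ (hE i hi) (hfin i hi)).const_mul _
  have h2 : Integrable (fun x => l ^ 2 * ∑ i ∈ I, ∑ j ∈ I,
      (E i ∩ E j).indicator (1 : α → ℝ) x) μ :=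
    (integrable_finsetSum I fun i hi => integrable_finsetSum I fun j hj =>
      hint2 i hi j hj).const_mul _
  have key := integral_mono (h1.sub h2) (hint _ hU hUfin) hpt
  rw [integral_indicator_one hU] at key
  simp only [Pi.sub_apply] at key
  rw [integral_sub h1 h2, integral_const_mul, integral_const_mul,
    integral_finsetSum I fun i hi => hint _ (hE i hi) (hfin i hi),
    integral_finsetSum I fun i hi => integrable_finsetSum I fun j hj => hint2 i hi j hj] at key
  refine le_of_eq_of_le ?_ key
  congr 2
  · exact Finset.sum_congr rfl fun i hi => (integral_indicator_one (hE i hi)).symm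
  · refine Finset.sum_congr rfl fun i hi => ?_
    rw [integral_finsetSum I fun j hj => hint2 i hi j hj]
    exact Finset.sum_congr rfl fun j hj =>
      (integral_indicator_one ((hE i hi).inter (hE j hj))).symm

theorem card_filter_abs_sub_le (K : Finset ℤ) (p : ℤ → ℝ) {ρ u y : ℝ} (hρ : 0 < ρ) (hu : 0 ≤ u)
    (hp : ∀ k ∈ K, |p k - k * ρ| ≤ 2 * ρ) :
    ((K.filter fun k => |p k - y| ≤ u).card : ℝ) ≤ 2 * u / ρ + 5 := by
  have hsub : (K.filter fun k => |p k - y| ≤ u) ⊆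
      Finset.Icc ⌈(y - u - 2 * ρ) / ρ⌉ ⌊(y + u + 2 * ρ) / ρ⌋ := by
    intro k hk
    rw [Finset.mem_filter] at hk
    have h1 := abs_le.1 (hp k hk.1)
    have h2 := abs_le.1 hk.2
    rw [Finset.mem_Icc, Int.ceil_le, Int.le_floor, div_le_iff₀ hρ, le_div_iff₀ hρ]
    constructor <;> linarith
  have h1 := Finset.card_le_card hsub
  rw [Int.card_Icc] at h1
  have h2 := Int.le_ceil ((y - u - 2 * ρ) / ρ)
  have h3 := Int.floor_le ((y + u + 2 * ρ) / ρ)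
  have e1 : (y + u + 2 * ρ) / ρ - (y - u - 2 * ρ) / ρ = 2 * u / ρ + 4 := by field_simp; ring
  have h4 : ((K.filter fun k => |p k - y| ≤ u).card : ℝ) ≤
      ((⌊(y + u + 2 * ρ) / ρ⌋ + 1 - ⌈(y - u - 2 * ρ) / ρ⌉).toNat : ℝ) := by exact_mod_cast h1
  rcases le_total 0 (⌊(y + u + 2 * ρ) / ρ⌋ + 1 - ⌈(y - u - 2 * ρ) / ρ⌉) with h | h
  · have h5 : (((⌊(y + u + 2 * ρ) / ρ⌋ + 1 - ⌈(y - u - 2 * ρ) / ρ⌉).toNat : ℤ) : ℝ) =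
        ((⌊(y + u + 2 * ρ) / ρ⌋ + 1 - ⌈(y - u - 2 * ρ) / ρ⌉ : ℤ) : ℝ) := by
      rw [Int.toNat_of_nonneg h]
    push_cast at h5
    linarith
  · rw [Int.toNat_of_nonpos h, Nat.cast_zero] at h4
    have : 0 ≤ 2 * u / ρ := by positivity
    linarith

theorem Finset.sum_sum_le_two_mul_of_symm (F : Finset ℕ) (S : ℕ → ℕ → ℝ)
    (hS : ∀ s t, 0 ≤ S s t) (hsymm : ∀ s t, S s t = S t s) :
    ∑ s ∈ F, ∑ t ∈ F, S s t ≤ 2 * ∑ s ∈ F, ∑ t ∈ F.filter (s ≤ ·), S s t := by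
  have h1 : ∑ s ∈ F, ∑ t ∈ F, S s t ≤ ∑ s ∈ F, ∑ t ∈ F, ((if s ≤ t then S s t else 0) +
      (if t ≤ s then S t s else 0)) := by
    refine Finset.sum_le_sum fun s _ => Finset.sum_le_sum fun t _ => ?_
    rcases le_total s t with h | h
    · rw [if_pos h]
      split_ifs <;> linarith [hS t s]
    · rw [if_pos h, hsymm s t]
      split_ifs <;> linarith [hS t s]
  simp only [Finset.sum_add_distrib] at h1
  rw [Finset.sum_comm (f := fun s t => if t ≤ s then S t s else 0)] at h1
  simp only [Finset.sum_filter]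
  linarith

theorem le_volume_biUnion_closedBall (F : Finset ℕ) (K : ℕ → Finset ℤ) (p : ℕ → ℤ → ℝ)
    (ρ r : ℕ → ℝ) {V : ℝ} (hρ : ∀ t ∈ F, 0 < ρ t) (hr0 : ∀ t, 0 < r t) (hr : Antitone r)
    (hr2 : ∀ s ∈ F, ∑ t ∈ F.filter (s ≤ ·), r t ≤ 2 * r s)
    (hp : ∀ t ∈ F, ∀ k ∈ K t, |p t k - k * ρ t| ≤ 2 * ρ t)
    (hK : ∀ t ∈ F, V / 2 ≤ (K t).card * ρ t) (hK' : ∀ t ∈ F, (K t).card * ρ t ≤ 2 * V)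
    (hW : 1 ≤ ∑ t ∈ F, r t / ρ t) :
    V / 112 ≤ volume.real (⋃ t ∈ F, ⋃ k ∈ K t, Metric.closedBall (p t k) (r t)) := by
  set W := ∑ t ∈ F, r t / ρ t with hWdef
  have hV : 0 ≤ V := by
    have hne : F.Nonempty := by
      by_contra h
      rw [Finset.not_nonempty_iff_eq_empty] at h
      rw [hWdef, h, Finset.sum_empty] at hW
      linarith
    obtain ⟨t, ht⟩ := hne
    linarith [mul_nonneg (Nat.cast_nonneg (α := ℝ) (K t).card) (hρ t ht).le, hK' t ht]
  let E : (Σ _ : ℕ, ℤ) → Set ℝ := fun i => Metric.closedBall (p i.1 i.2) (r i.1)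
  let I : Finset (Σ _ : ℕ, ℤ) := F.sigma K
  have hvol : ∀ i, volume.real (E i) = 2 * r i.1 := fun i =>
    Real.volume_real_closedBall (hr0 _).le
  have hUnion : (⋃ t ∈ F, ⋃ k ∈ K t, Metric.closedBall (p t k) (r t)) = ⋃ i ∈ I, E i := by
    ext x
    simp [I, E, Finset.mem_sigma, and_assoc]
  have hmom := two_mul_sum_sub_le_measureReal_biUnion (μ := volume) I E
    (fun i _ => measurableSet_closedBall) (fun i _ => measure_closedBall_lt_top.ne)
    (1 / (112 * W))
  rw [hUnion]
  refine le_trans ?_ hmom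
  have hfirst : V * W ≤ ∑ i ∈ I, volume.real (E i) := by
    rw [Finset.sum_sigma, hWdef, Finset.mul_sum]
    refine Finset.sum_le_sum fun t ht => ?_
    simp only [hvol, Finset.sum_const, nsmul_eq_mul]
    have := hρ t ht
    have h1 := hK t ht
    have h2 := hr0 t
    rw [mul_div_assoc', div_le_iff₀ this]
    nlinarith
  have hpair : ∀ s ∈ F, ∀ t ∈ F, s ≤ t →
      ∑ k ∈ K s, ∑ l ∈ K t, volume.real (E ⟨s, k⟩ ∩ E ⟨t, l⟩) ≤
        16 * V * (r s / ρ s * (r t / ρ t)) + 20 * V * (r t / ρ s) := by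
    intro s hs t ht hst
    have hρs := hρ s hs
    have hρt := hρ t ht
    have hrs := hr0 s
    have hrt := hr0 t
    have h1 : ∀ k ∈ K s, ∑ l ∈ K t, volume.real (E ⟨s, k⟩ ∩ E ⟨t, l⟩) ≤
        (4 * r s / ρ t + 5) * (2 * r t) := by
      intro k _
      have h2 : ∀ l ∈ K t, volume.real (E ⟨s, k⟩ ∩ E ⟨t, l⟩) ≤
          if |p t l - p s k| ≤ 2 * r s then 2 * r t else 0 := by
        intro l _
        split_ifs with h
        · rw [← hvol ⟨t, l⟩]
          exact measureReal_mono Set.inter_subset_right measure_closedBall_lt_top.ne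
        · have : E ⟨s, k⟩ ∩ E ⟨t, l⟩ = ∅ := by
            rw [Set.eq_empty_iff_forall_notMem]
            rintro x ⟨hx1, hx2⟩
            simp only [E, Metric.mem_closedBall] at hx1 hx2
            apply h
            rw [← Real.dist_eq]
            have := dist_triangle_left (p t l) (p s k) x
            linarith [hr hst]
          rw [this, measureReal_empty]
      refine (Finset.sum_le_sum h2).trans ?_
      rw [← Finset.sum_filter, Finset.sum_const, nsmul_eq_mul]
      have h3 := card_filter_abs_sub_le (K t) (p t) (u := 2 * r s) (y := p s k) hρt
        (by positivity) (hp t ht)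
      rw [show 2 * (2 * r s) / ρ t = 4 * r s / ρ t by ring] at h3
      gcongr
    refine (Finset.sum_le_sum h1).trans ?_
    rw [Finset.sum_const, nsmul_eq_mul]
    calc ((K s).card : ℝ) * ((4 * r s / ρ t + 5) * (2 * r t))
        = (K s).card * ρ s * ((4 * r s / ρ t + 5) * (2 * r t) / ρ s) := by field_simp
      _ ≤ 2 * V * ((4 * r s / ρ t + 5) * (2 * r t) / ρ s) :=
          mul_le_mul_of_nonneg_right (hK' s hs) (by positivity)
      _ = _ := by field_simp; ring
  have hsecond : ∑ i ∈ I, ∑ j ∈ I, volume.real (E i ∩ E j) ≤ 112 * V * W ^ 2 := by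
    have h1 : ∑ i ∈ I, ∑ j ∈ I, volume.real (E i ∩ E j) =
        ∑ s ∈ F, ∑ t ∈ F, ∑ k ∈ K s, ∑ l ∈ K t, volume.real (E ⟨s, k⟩ ∩ E ⟨t, l⟩) := by
      simp only [I, Finset.sum_sigma]
      exact Finset.sum_congr rfl fun s _ => Finset.sum_comm
    rw [h1]
    refine (Finset.sum_sum_le_two_mul_of_symm F _
      (fun s t => Finset.sum_nonneg fun k _ => Finset.sum_nonneg fun l _ => measureReal_nonneg)
      (fun s t => ?_)).trans ?_
    · rw [Finset.sum_comm]
      simp only [Set.inter_comm]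
    have h2 : ∑ s ∈ F, ∑ t ∈ F.filter (s ≤ ·),
        ∑ k ∈ K s, ∑ l ∈ K t, volume.real (E ⟨s, k⟩ ∩ E ⟨t, l⟩) ≤
        ∑ s ∈ F, (16 * V * W + 40 * V) * (r s / ρ s) := by
      refine Finset.sum_le_sum fun s hs => ?_
      have hρs := hρ s hs
      have hrs := hr0 s
      calc _ ≤ ∑ t ∈ F.filter (s ≤ ·),
            (16 * V * (r s / ρ s * (r t / ρ t)) + 20 * V * (r t / ρ s)) :=
            Finset.sum_le_sum fun t ht => by
              rw [Finset.mem_filter] at ht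
              exact hpair s hs t ht.1 ht.2
        _ = 16 * V * (r s / ρ s) * ∑ t ∈ F.filter (s ≤ ·), r t / ρ t +
            20 * V / ρ s * ∑ t ∈ F.filter (s ≤ ·), r t := by
            rw [Finset.sum_add_distrib, Finset.mul_sum, Finset.mul_sum]
            congr 1 <;> exact Finset.sum_congr rfl fun t _ => by ring
        _ ≤ 16 * V * (r s / ρ s) * W + 20 * V / ρ s * (2 * r s) := by
            gcongr
            · exact Finset.sum_le_sum_of_subset_of_nonneg (Finset.filter_subset _ _)
                fun t ht _ => div_nonneg (hr0 t).le (hρ t ht).le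
            · exact hr2 s hs
        _ = _ := by ring
    rw [← Finset.mul_sum, ← hWdef] at h2
    have h3 : V * W ≤ V * W ^ 2 :=
      mul_le_mul_of_nonneg_left (by nlinarith) hV
    calc _ ≤ 2 * ((16 * V * W + 40 * V) * W) := by gcongr
      _ = 32 * (V * W ^ 2) + 80 * (V * W) := by ring
      _ ≤ _ := by linarith
  have hW0 : 0 < W := by linarith
  calc V / 112 = 2 * (1 / (112 * W)) * (V * W) - (1 / (112 * W)) ^ 2 * (112 * V * W ^ 2) := by
        field_simp; norm_num
    _ ≤ _ := by gcongr

theorem exists_separated_centres {a b ρ : ℝ} (hρ : 0 < ρ) (hρab : ρ ≤ (b - a) / 2) (R : Set ℝ)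
    (hub : volume {x | x ∈ Set.Icc a b ∧ ∀ y ∈ R, ρ < |x - y|} ≤ ENNReal.ofReal ((b - a) / 2)) :
    ∃ (K : Finset ℤ) (p : ℤ → ℝ), (∀ k ∈ K, p k ∈ R ∧ |p k - k * ρ| ≤ 2 * ρ ∧
      ∃ x ∈ Set.Icc a b, |x - p k| ≤ ρ) ∧ (b - a) / 2 ≤ K.card * ρ ∧
      K.card * ρ ≤ 2 * (b - a) := by
  classical
  have hab : a ≤ b := by linarith
  let P : ℤ → ℝ → ℝ → Prop := fun k x y => x ∈ Set.Icc a b ∧ ⌊x / ρ⌋ = k ∧ y ∈ R ∧ |x - y| ≤ ρ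
  let K := (Finset.Icc ⌊a / ρ⌋ ⌊b / ρ⌋).filter fun k => ∃ x y, P k x y
  have hex : ∀ k ∈ K, ∃ x y, P k x y := fun k hk => (Finset.mem_filter.1 hk).2
  choose! x p hP using hex
  refine ⟨K, p, fun k hk => ⟨(hP k hk).2.2.1, ?_, x k, (hP k hk).1, (hP k hk).2.2.2⟩, ?_, ?_⟩
  · obtain ⟨-, h2, -, h4⟩ := hP k hk
    rw [Int.floor_eq_iff, le_div_iff₀ hρ, div_lt_iff₀ hρ] at h2
    rw [abs_le] at h4 ⊢
    constructor <;> linarith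
  · have hcover : Set.Icc a b ⊆ {x | x ∈ Set.Icc a b ∧ ∀ y ∈ R, ρ < |x - y|} ∪
        ⋃ k ∈ K, Set.Icc (k * ρ) ((k + 1) * ρ) := by
      intro x hx
      by_cases h : ∀ y ∈ R, ρ < |x - y|
      · exact Or.inl ⟨hx, h⟩
      · push Not at h
        obtain ⟨y, hy, hxy⟩ := h
        refine Or.inr (Set.mem_biUnion (x := ⌊x / ρ⌋) ?_ ?_)
        · refine Finset.mem_filter.2 ⟨Finset.mem_Icc.2 ⟨?_, ?_⟩, x, y, hx, rfl, hy, hxy⟩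
          · exact Int.floor_le_floor (by gcongr; exact hx.1)
          · exact Int.floor_le_floor (by gcongr; exact hx.2)
        · have h1 := Int.floor_le (x / ρ)
          have h2 := Int.lt_floor_add_one (x / ρ)
          rw [le_div_iff₀ hρ] at h1
          rw [div_lt_iff₀ hρ] at h2
          exact ⟨h1, h2.le⟩
    have h1 := (measure_mono hcover).trans ((measure_union_le (μ := volume) _ _).trans
      (add_le_add hub (measure_biUnion_finset_le K _)))
    simp only [Real.volume_Icc, add_mul, one_mul, add_sub_cancel_left, Finset.sum_const,
      nsmul_eq_mul] at h1
    rw [← ENNReal.ofReal_natCast, ← ENNReal.ofReal_mul (by positivity),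
      ← ENNReal.ofReal_add (by linarith) (by positivity),
      ENNReal.ofReal_le_ofReal_iff (by nlinarith [show (0 : ℝ) ≤ K.card * ρ by positivity])] at h1
    linarith
  · have h1 : K.card ≤ (⌊b / ρ⌋ + 1 - ⌊a / ρ⌋).toNat := by
      rw [← Int.card_Icc]
      exact Finset.card_filter_le _ _
    have h2 : ⌊a / ρ⌋ ≤ ⌊b / ρ⌋ := Int.floor_le_floor (by gcongr)
    have h3 : (K.card : ℤ) ≤ ⌊b / ρ⌋ + 1 - ⌊a / ρ⌋ := by omega
    have h4 : (K.card : ℝ) ≤ ⌊b / ρ⌋ + 1 - ⌊a / ρ⌋ := by exact_mod_cast h3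
    have h5 := Int.floor_le (b / ρ)
    have h6 := Int.lt_floor_add_one (a / ρ)
    calc (K.card : ℝ) * ρ ≤ (b / ρ - a / ρ + 2) * ρ := by gcongr; linarith
      _ = b - a + 2 * ρ := by field_simp
      _ ≤ _ := by linarith

theorem sum_filter_le_two_mul {r : ℕ → ℝ} (hr0 : ∀ t, 0 < r t) (hr : ∀ t, r (t + 1) ≤ r t / 2)
    (F : Finset ℕ) (s : ℕ) : ∑ t ∈ F.filter (s ≤ ·), r t ≤ 2 * r s := by
  have key : ∀ n : ℕ, ∑ i ∈ Finset.range n, r (s + i) ≤ 2 * r s - 2 * r (s + n) := by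
    intro n
    induction n with
    | zero => simp
    | succ n ih =>
      rw [Finset.sum_range_succ]
      have := hr (s + n)
      rw [← add_assoc]
      linarith
  obtain ⟨m, hm⟩ := F.exists_nat_subset_range
  have hsub : F.filter (s ≤ ·) ⊆ (Finset.range m).map (addLeftEmbedding s) := by
    intro t ht
    rw [Finset.mem_filter] at ht
    have := Finset.mem_range.1 (hm ht.1)
    rw [Finset.mem_map]
    exact ⟨t - s, Finset.mem_range.2 (by omega), by simp [ht.2]⟩
  refine (Finset.sum_le_sum_of_subset_of_nonneg hsub fun t _ _ => (hr0 t).le).trans ?_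
  rw [Finset.sum_map]
  simp only [addLeftEmbedding_apply]
  linarith [key m, hr0 (s + m)]

theorem tendsto_zero_of_succ_le_half {r : ℕ → ℝ} (hr0 : ∀ t, 0 < r t)
    (hr : ∀ t, r (t + 1) ≤ r t / 2) : Tendsto r atTop (nhds 0) := by
  have h : ∀ t, r t ≤ r 0 * (1 / 2) ^ t := by
    intro t
    induction t with
    | zero => simp
    | succ t ih =>
      rw [pow_succ]
      linarith [hr t]
  refine squeeze_zero (fun t => (hr0 t).le) h ?_
  simpa using (tendsto_pow_atTop_nhds_zero_of_lt_one (by norm_num : (0 : ℝ) ≤ 1 / 2)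
    (by norm_num)).const_mul (r 0)

/-- Points approximable infinitely often by a locally ubiquitous system. -/
theorem volume_diff_limsup_le {a b : ℝ} (hab : a < b) (T : Set ℕ) (R : ℕ → Set ℝ) (ρ r : ℕ → ℝ)
    (hr0 : ∀ t, 0 < r t) (hr : ∀ t, r (t + 1) ≤ r t / 2) (hρ0 : ∀ t ∈ T, 0 < ρ t)
    (hρ : ∀ ε > 0, ∀ᶠ t in atTop, t ∈ T → ρ t ≤ ε)
    (hub : ∀ᶠ t in atTop, t ∈ T → volume {x | x ∈ Set.Icc a b ∧ ∀ y ∈ R t, ρ t < |x - y|} ≤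
      ENNReal.ofReal ((b - a) / 2))
    (hdiv : ¬ Summable (T.indicator fun t => r t / ρ t)) :
    volume (Set.Icc a b \ {x | ∃ᶠ t in atTop, t ∈ T ∧ ∃ y ∈ R t, |x - y| ≤ r t}) ≤
      ENNReal.ofReal (111 / 112 * (b - a)) := by
  classical
  set V := b - a with hV
  have hV0 : 0 < V := by linarith
  have hrt := tendsto_zero_of_succ_le_half hr0 hr
  have hranti : Antitone r := antitone_nat_of_succ_le fun t => by linarith [hr t, hr0 t]
  have hev := (hρ (V / 2) (by positivity)).and hub
  obtain ⟨m₀, hm₀⟩ := eventually_atTop.1 hev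
  have hex : ∀ t, ∃ (K : Finset ℤ) (p : ℤ → ℝ), t ∈ T → m₀ ≤ t →
      (∀ k ∈ K, p k ∈ R t ∧ |p k - k * ρ t| ≤ 2 * ρ t ∧ ∃ x ∈ Set.Icc a b, |x - p k| ≤ ρ t) ∧
      V / 2 ≤ K.card * ρ t ∧ K.card * ρ t ≤ 2 * V := by
    intro t
    by_cases h : t ∈ T ∧ m₀ ≤ t
    · obtain ⟨K, p, hKp⟩ := exists_separated_centres (hρ0 t h.1) ((hm₀ t h.2).1 h.1) (R t)
        ((hm₀ t h.2).2 h.1)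
      exact ⟨K, p, fun _ _ => hKp⟩
    · exact ⟨∅, 0, fun h1 h2 => absurd ⟨h1, h2⟩ h⟩
  choose K p hKp using hex
  let U : ℕ → Set ℝ := fun m => ⋃ t, ⋃ (_ : t ∈ T ∧ m₀ + m ≤ t), ⋃ k ∈ K t,
    Metric.closedBall (p t k) (r t)
  have hUmeas : ∀ m, MeasurableSet (U m) := fun m => MeasurableSet.iUnion fun t =>
    MeasurableSet.iUnion fun _ => Finset.measurableSet_biUnion _ fun k _ =>
      measurableSet_closedBall
  have hUanti : Antitone U := by
    intro m n hmn x hx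
    simp only [U, Set.mem_iUnion] at hx ⊢
    obtain ⟨t, ht, h⟩ := hx
    exact ⟨t, ⟨ht.1, by omega⟩, h⟩
  have hUnear : ∀ ε > 0, ∃ m, ∀ x ∈ U m, ∃ z ∈ Set.Icc a b, |x - z| ≤ ε := by
    intro ε hε
    obtain ⟨m, hm⟩ := eventually_atTop.1 ((hρ (ε / 2) (by positivity)).and
      (hrt.eventually_le_const (show 0 < ε / 2 by positivity)))
    refine ⟨m, fun x hx => ?_⟩
    simp only [U, Set.mem_iUnion] at hx
    obtain ⟨t, ⟨htT, ht⟩, k, hk, hx⟩ := hx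
    obtain ⟨z, hz, hzp⟩ := (((hKp t htT (by omega)).1 k hk).2).2
    refine ⟨z, hz, ?_⟩
    rw [Metric.mem_closedBall, Real.dist_eq] at hx
    have h1 := (hm t (by omega)).1 htT
    have h2 := (hm t (by omega)).2
    rw [abs_le] at *
    constructor <;> linarith
  have hUlow : ∀ m, ENNReal.ofReal (V / 112) ≤ volume (U m) := by
    intro m
    obtain ⟨F₀, hF₀⟩ : ∃ F : Finset ℕ, (∀ t ∈ F, m₀ + m ≤ t ∧ t ∈ T) ∧
        1 ≤ ∑ t ∈ F, r t / ρ t := by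
      by_contra! hcon
      apply hdiv
      rw [← summable_nat_add_iff (m₀ + m)]
      refine summable_of_sum_le (c := 1) (fun i => ?_) (fun u => ?_)
      · exact Set.indicator_nonneg (fun t ht => div_nonneg (hr0 t).le (hρ0 t ht).le) _
      · have := hcon ((u.map (addRightEmbedding (m₀ + m))).filter (· ∈ T)) (fun t ht => by
          rw [Finset.mem_filter, Finset.mem_map] at ht
          obtain ⟨⟨i, -, rfl⟩, h⟩ := ht
          exact ⟨by simp, h⟩)
        rw [Finset.sum_filter, Finset.sum_map] at this
        simpa [Set.indicator_apply] using this.le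
    have h1 := le_volume_biUnion_closedBall F₀ K p ρ r (V := V)
      (fun t ht => hρ0 t (hF₀.1 t ht).2) hr0 hranti
      (fun s _ => sum_filter_le_two_mul hr0 hr F₀ s)
      (fun t ht k hk => ((hKp t (hF₀.1 t ht).2 (by have := (hF₀.1 t ht).1; omega)).1 k hk).2.1)
      (fun t ht => (hKp t (hF₀.1 t ht).2 (by have := (hF₀.1 t ht).1; omega)).2.1)
      (fun t ht => (hKp t (hF₀.1 t ht).2 (by have := (hF₀.1 t ht).1; omega)).2.2) hF₀.2
    refine (ENNReal.ofReal_le_of_le_toReal h1).trans (measure_mono ?_)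
    intro x hx
    simp only [U, Set.mem_iUnion] at hx ⊢
    obtain ⟨t, ht, h⟩ := hx
    exact ⟨t, ⟨(hF₀.1 t ht).2, (hF₀.1 t ht).1⟩, h⟩
  have hfin : ∃ m, volume (U m) ≠ ⊤ := by
    obtain ⟨m, hm⟩ := hUnear 1 one_pos
    refine ⟨m, ((measure_mono (t := Set.Icc (a - 1) (b + 1)) fun x hx => ?_).trans_lt
      measure_Icc_lt_top).ne⟩
    obtain ⟨z, hz, hxz⟩ := hm x hx
    rw [abs_le] at hxz
    exact ⟨by linarith [hz.1], by linarith [hz.2]⟩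
  have hlim := tendsto_measure_iInter_atTop (μ := volume)
    (fun m => (hUmeas m).nullMeasurableSet) hUanti hfin
  have hlow : ENNReal.ofReal (V / 112) ≤ volume (⋂ m, U m) :=
    ge_of_tendsto' hlim hUlow
  have hsub : (⋂ m, U m) ⊆ Set.Icc a b := by
    intro x hx
    rw [← isClosed_Icc.closure_eq, Metric.mem_closure_iff]
    intro ε hε
    obtain ⟨m, hm⟩ := hUnear (ε / 2) (by positivity)
    obtain ⟨z, hz, hxz⟩ := hm x (Set.mem_iInter.1 hx m)
    exact ⟨z, hz, by rw [Real.dist_eq]; linarith⟩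
  have hmem : (⋂ m, U m) ⊆ {x | ∃ᶠ t in atTop, t ∈ T ∧ ∃ y ∈ R t, |x - y| ≤ r t} := by
    intro x hx
    rw [Set.mem_ofPred_eq, frequently_atTop]
    intro m
    have := Set.mem_iInter.1 hx m
    simp only [U, Set.mem_iUnion] at this
    obtain ⟨t, ⟨htT, ht⟩, k, hk, hx⟩ := this
    exact ⟨t, by omega, htT, p t k, ((hKp t htT (by omega)).1 k hk).1, hx⟩
  calc volume (Set.Icc a b \ {x | ∃ᶠ t in atTop, t ∈ T ∧ ∃ y ∈ R t, |x - y| ≤ r t})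
      ≤ volume (Set.Icc a b \ ⋂ m, U m) := measure_mono (Set.sdiff_subset_sdiff_right hmem)
    _ = volume (Set.Icc a b) - volume (⋂ m, U m) :=
        measure_sdiff hsub (MeasurableSet.iInter hUmeas).nullMeasurableSet
          (measure_ne_top_of_subset hsub measure_Icc_lt_top.ne)
    _ ≤ ENNReal.ofReal V - ENNReal.ofReal (V / 112) := by
        rw [Real.volume_Icc]
        gcongr
    _ = ENNReal.ofReal (111 / 112 * V) := by
        rw [← ENNReal.ofReal_sub _ (by positivity)]
        congr 1; ring

theorem exists_scale : ∃ ξ : ℝ, 1 < ξ ∧ ξ ^ 100 = 2 := by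
  refine ⟨2 ^ (100 : ℝ)⁻¹, Real.one_lt_rpow (by norm_num) (by norm_num), ?_⟩
  have := Real.rpow_inv_natCast_pow (n := 100) (x := 2) (by norm_num) (by norm_num)
  exact_mod_cast this

theorem not_summable_indicator_of_not_summable_sq {ψ : ℝ → ℝ} (hψ : IsApproxFun ψ)
    (hdiv : ¬ Summable (fun h : ℕ => ψ h ^ 2)) {ξ C : ℝ} (hξ : 1 < ξ) (hξ2 : ξ ^ 100 = 2)
    (hC : 0 < C) {δ : ℕ → ℝ} (hδ : ∀ t, δ t = min (ψ (2 ^ t) / C) ((ξ ^ t) ^ 50)⁻¹) :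
    ¬ Summable ({t | 1 ≤ δ t * (ξ ^ t) ^ 51}.indicator fun t => 2 ^ t * δ t ^ 2) := by
  intro hsum
  apply hdiv
  have hξ0 : 0 < ξ := by linarith
  have hψ0 : ∀ t : ℕ, 0 < ψ (2 ^ t) := fun t => hψ.2 _ (by positivity)
  have hδ0 : ∀ t, 0 < δ t := fun t => by
    rw [hδ]
    exact lt_min (div_pos (hψ0 t) hC) (by positivity)
  have h2 : ∀ t : ℕ, (2 : ℝ) ^ t = (ξ ^ t) ^ 100 := fun t => by
    rw [← hξ2, ← pow_mul, ← pow_mul, mul_comm]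
  have hall : Summable fun t => 2 ^ t * δ t ^ 2 := by
    have hgeo : Summable fun t : ℕ => (1 / ξ ^ 2) ^ t := by
      apply summable_geometric_of_lt_one (by positivity)
      rw [div_lt_one (by positivity)]
      exact one_lt_pow₀ hξ (by norm_num)
    refine (hsum.add hgeo).of_nonneg_of_le (fun t => by positivity) fun t => ?_
    have hg : 0 ≤ (1 / ξ ^ 2) ^ t := by positivity
    by_cases ht : t ∈ {t | 1 ≤ δ t * (ξ ^ t) ^ 51}
    · rw [Set.indicator_of_mem ht]
      linarith
    · rw [Set.indicator_of_notMem ht, zero_add]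
      rw [Set.mem_ofPred_eq, not_le] at ht
      have h3 : δ t ≤ 1 / (ξ ^ t) ^ 51 := by
        rw [le_div_iff₀ (by positivity)]
        exact ht.le
      calc 2 ^ t * δ t ^ 2 ≤ (ξ ^ t) ^ 100 * (1 / (ξ ^ t) ^ 51) ^ 2 := by
            rw [h2]
            have := (hδ0 t).le
            gcongr
        _ = 1 / (ξ ^ t) ^ 2 := by field_simp
        _ = _ := by rw [div_pow, one_pow, ← pow_mul, ← pow_mul, mul_comm]
  have hev : (fun t : ℕ => 2 ^ t * (ψ (2 ^ t) / C) ^ 2) =ᶠ[cofinite] fun t => 2 ^ t * δ t ^ 2 := by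
    rw [Nat.cofinite_eq_atTop]
    filter_upwards [hall.tendsto_atTop_zero.eventually_lt_const one_pos] with t ht
    rcases min_choice (ψ (2 ^ t) / C) ((ξ ^ t) ^ 50)⁻¹ with h | h
    · rw [hδ, h]
    · rw [hδ, h, h2] at ht
      exfalso
      have : (ξ ^ t) ^ 100 * (((ξ ^ t) ^ 50)⁻¹) ^ 2 = 1 := by field_simp
      linarith
  have h3 : Summable fun t : ℕ => 2 ^ t * (ψ (2 ^ t) / C) ^ 2 :=
    (summable_congr_cofinite hev).2 hall
  have h4 : Summable fun t : ℕ => (2 : ℝ) ^ t * ψ ((2 ^ t : ℕ) : ℝ) ^ 2 := by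
    refine (h3.mul_left (C ^ 2)).congr fun t => ?_
    push_cast
    field_simp
  have hanti : ∀ ⦃m n : ℕ⦄, 0 < m → m ≤ n → ψ n ^ 2 ≤ ψ m ^ 2 := fun m n hm hmn =>
    pow_le_pow_left₀ (hψ.2 _ (by exact_mod_cast hm.trans_le hmn)).le
      (hψ.1 _ _ (by exact_mod_cast hm) (by exact_mod_cast hmn)) 2
  exact (summable_condensed_iff_of_nonneg (f := fun n : ℕ => ψ n ^ 2) (fun n => sq_nonneg _)
    hanti).1 h4

theorem distNearestInt_le (x : ℝ) (n : ℤ) : distNearestInt x ≤ |x - n| := round_le x n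

/-- The rational points with denominator of order `Q` that are within `3 δ / Q` of the graph. -/
def rationalsNearGraph (f : ℝ → ℝ) (Q δ : ℝ) : Set ℝ :=
  {y | ∃ q p s : ℤ, 1 / 10000 * Q < q ∧ (q : ℝ) ≤ Q ∧ y = p / q ∧ |q * f y - s| ≤ 3 * δ}

namespace ConvexArc

variable {f f₁ : ℝ → ℝ} {A B c M : ℝ}

theorem abs_sub_le (hf : ConvexArc f f₁ A B c M) {x y : ℝ} (hx : x ∈ Set.Icc A B)
    (hy : y ∈ Set.Icc A B) : |f y - f x| ≤ M * |y - x| :=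
  (convex_Icc A B).norm_image_sub_le_of_norm_hasDerivWithin_le
    (fun z hz => (hf.hasDerivAt z hz).hasDerivWithinAt) hf.bound hx hy

theorem exists_rationalsNearGraph (hf : ConvexArc f f₁ A B c M) {Q : ℕ} {δ x : ℝ} (hδ0 : 0 < δ)
    (hδ1 : δ ≤ 1) (hQ : 1 ≤ Q * δ) (hM : 4 * M ≤ Q ^ 2 * δ ^ 3)
    (hA : 20000 / (Q ^ 2 * δ) ≤ x - A) (hB : 20000 / (Q ^ 2 * δ) ≤ B - x)
    (hx : x ∉ nearRationalSet f f₁ (1 / 10000 * Q) (2 / (Q * δ)) (2 * δ)) :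
    ∃ y ∈ rationalsNearGraph f Q δ, |x - y| ≤ 20000 / (Q ^ 2 * δ) := by
  obtain ⟨q, p, s, h0, h1, h2, h3⟩ := mem_nearRationalSet f f₁ hδ0 hδ1 hQ x
  have hQ0 : (0 : ℝ) < Q := pos_of_mul_pos_left (by linarith) hδ0.le
  have hq : 1 / 10000 * (Q : ℝ) < q := by
    by_contra! h
    exact hx ⟨q, p, s, h0, h, h2, h3⟩
  have hq0 : (0 : ℝ) < q := by exact_mod_cast h0
  have hxy : |x - (p : ℝ) / q| ≤ 20000 / (Q ^ 2 * δ) := by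
    rw [show x - (p : ℝ) / q = (q * x - p) / q by field_simp, abs_div, abs_of_pos hq0]
    calc |q * x - p| / q ≤ 2 / (Q * δ) / (1 / 10000 * Q) := by gcongr
      _ = _ := by field_simp; norm_num
  have hpos : 0 < 20000 / (Q ^ 2 * δ) := by positivity
  have hyAB : (p : ℝ) / q ∈ Set.Icc A B := by
    rw [abs_le] at hxy
    constructor <;> linarith
  refine ⟨p / q, ⟨q, p, s, hq, h1, rfl, ?_⟩, hxy⟩
  refine (hf.abs_mul_apply_div_sub_le (x := x) ⟨by linarith, by linarith⟩ h0 hyAB h2 h3).trans ?_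
  have : M * (2 / (Q * δ)) ^ 2 ≤ δ := by
    rw [show M * (2 / (Q * δ)) ^ 2 = 4 * M / (Q ^ 2 * δ ^ 2) by field_simp; norm_num,
      div_le_iff₀ (by positivity)]
    linarith
  linarith

theorem approx_of_near_rationalsNearGraph (hf : ConvexArc f f₁ A B c M) {Q δ x y : ℝ}
    (hQ : 0 < Q) (hx : x ∈ Set.Icc A B) (hy : y ∈ Set.Icc A B)
    (hyR : y ∈ rationalsNearGraph f Q δ) (hxy : |x - y| ≤ δ / Q) :
    ∃ q : ℕ, 0 < q ∧ 1 / 10000 * Q < q ∧ (q : ℝ) ≤ Q ∧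
      max (distNearestInt (q * x)) (distNearestInt (q * f x)) ≤ (3 + M) * δ := by
  have hM := hf.one_le
  obtain ⟨q, p, s, h1, h2, h3, h4⟩ := hyR
  have hq0 : (0 : ℝ) < q := by linarith
  have hq0' : 0 < q := by exact_mod_cast hq0
  lift q to ℕ using hq0'.le
  simp only [Int.cast_natCast] at *
  have hδ : 0 ≤ δ := by
    have := (abs_nonneg _).trans h4
    linarith
  have hqxy : q * |x - y| ≤ δ := by
    calc q * |x - y| ≤ Q * (δ / Q) := by gcongr
      _ = δ := by field_simp
  refine ⟨q, by exact_mod_cast hq0, h1, h2, max_le ?_ ?_⟩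
  · refine (distNearestInt_le _ p).trans ?_
    rw [show (q : ℝ) * x - p = q * (x - y) by rw [h3]; field_simp, abs_mul, abs_of_pos hq0]
    nlinarith
  · refine (distNearestInt_le _ s).trans ?_
    rw [show (q : ℝ) * f x - s = (q * f y - s) + q * (f x - f y) by ring]
    refine (abs_add_le _ _).trans ?_
    rw [abs_mul, abs_of_pos hq0]
    have := hf.abs_sub_le hy hx
    calc |q * f y - s| + q * |f x - f y| ≤ 3 * δ + q * (M * |x - y|) := by gcongr
      _ = 3 * δ + M * (q * |x - y|) := by ring
      _ ≤ 3 * δ + M * δ := by gcongr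
      _ = _ := by ring

end ConvexArc

namespace ConvexArc

variable {f f₁ : ℝ → ℝ} {A B c M : ℝ}

theorem volume_diff_simApprox2_le (hf : ConvexArc f f₁ A B c M) {ψ : ℝ → ℝ} (hψ : IsApproxFun ψ)
    (hdiv : ¬ Summable (fun h : ℕ => ψ h ^ 2)) {a b : ℝ} (ha : A < a) (hab : a < b) (hb : b < B) :
    volume (Set.Icc a b \ {x | (x, f x) ∈ SimApprox2 ψ}) ≤
      ENNReal.ofReal (111 / 112 * (b - a)) := by
  have hM := hf.one_le
  have hc := hf.c_pos
  obtain ⟨ξ, hξ, hξ2⟩ := exists_scale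
  have hξ0 : 0 < ξ := by linarith
  have hX0 : ∀ t : ℕ, 0 < ξ ^ t := fun t => by positivity
  have hX1 : ∀ t : ℕ, 1 ≤ ξ ^ t := fun t => one_le_pow₀ hξ.le
  have h2 : ∀ t : ℕ, (2 : ℝ) ^ t = (ξ ^ t) ^ 100 := fun t => by
    rw [← hξ2, ← pow_mul, ← pow_mul, mul_comm]
  have hXlim : Tendsto (fun t : ℕ => ξ ^ t) atTop atTop := tendsto_pow_atTop_atTop_of_one_lt hξ
  have hψ0 : ∀ t : ℕ, 0 < ψ (2 ^ t) := fun t => hψ.2 _ (by positivity)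
  have hC : 0 < 4 + M := by linarith
  let δ : ℕ → ℝ := fun t => min (ψ (2 ^ t) / (4 + M)) ((ξ ^ t) ^ 50)⁻¹
  have hδ0 : ∀ t, 0 < δ t := fun t => lt_min (div_pos (hψ0 t) hC) (by positivity)
  have hδψ : ∀ t, (3 + M) * δ t < ψ (2 ^ t) := fun t => by
    have h1 : δ t ≤ ψ (2 ^ t) / (4 + M) := min_le_left _ _
    rw [le_div_iff₀ hC] at h1
    linarith [hδ0 t]
  have hδX : ∀ t, δ t * (ξ ^ t) ^ 50 ≤ 1 := fun t => by
    have h1 : δ t ≤ ((ξ ^ t) ^ 50)⁻¹ := min_le_right _ _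
    rwa [← one_div, le_div_iff₀ (by positivity)] at h1
  have hδ1 : ∀ t, δ t ≤ 1 := fun t =>
    (le_mul_of_one_le_right (hδ0 t).le (one_le_pow₀ (hX1 t))).trans (hδX t)
  have hδanti : ∀ t, δ (t + 1) ≤ δ t := fun t => by
    refine min_le_min ?_ ?_
    · gcongr
      exact hψ.1 _ _ (by positivity) (pow_le_pow_right₀ (by norm_num) (Nat.le_succ t))
    · gcongr
      · exact hξ.le
      · exact Nat.le_succ t
  set T : Set ℕ := {t | 1 ≤ δ t * (ξ ^ t) ^ 51} with hT
  let ρ : ℕ → ℝ := fun t => 20000 / ((2 ^ t) ^ 2 * δ t)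
  let r : ℕ → ℝ := fun t => δ t / 2 ^ t
  have hρX : ∀ t ∈ T, ρ t ≤ 20000 / ξ ^ t := fun t ht => by
    simp only [ρ]
    rw [h2]
    gcongr
    calc ξ ^ t = (ξ ^ t) ^ 1 * 1 := by ring
      _ ≤ (ξ ^ t) ^ 149 * (δ t * (ξ ^ t) ^ 51) := by
        gcongr ?_ * ?_
        · exact pow_le_pow_right₀ (hX1 t) (by norm_num)
        · exact ht
      _ = _ := by ring
  have hlarge : ∀ v : ℝ, ∀ᶠ t : ℕ in atTop, v ≤ ξ ^ t := fun v => hXlim.eventually_ge_atTop v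
  have hlarge' : ∀ u v : ℝ, 0 < v → ∀ᶠ t : ℕ in atTop, u ≤ v * ξ ^ t := fun u v hv => by
    filter_upwards [hlarge (u / v)] with t ht
    rwa [div_le_iff₀' hv] at ht
  have hρ : ∀ ε > 0, ∀ᶠ t in atTop, t ∈ T → ρ t ≤ ε := fun ε hε => by
    filter_upwards [hlarge' 20000 ε hε] with t ht htT
    refine (hρX t htT).trans ?_
    rwa [div_le_iff₀ (hX0 t)]
  have hr0 : ∀ t, 0 < r t := fun t => div_pos (hδ0 t) (by positivity)
  have hr : ∀ t, r (t + 1) ≤ r t / 2 := fun t => by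
    simp only [r]
    rw [div_div, pow_succ]
    gcongr
    exact hδanti t
  have hdiv' : ¬ Summable (T.indicator fun t => r t / ρ t) := by
    intro hs
    refine not_summable_indicator_of_not_summable_sq hψ hdiv hξ hξ2 hC (δ := δ) (fun t => rfl) ?_
    refine (hs.mul_left 20000).congr fun t => ?_
    by_cases ht : t ∈ T
    · rw [Set.indicator_of_mem ht, Set.indicator_of_mem ht]
      simp only [r, ρ]
      have := (hδ0 t).ne'
      field_simp
    · rw [Set.indicator_of_notMem ht, Set.indicator_of_notMem ht, mul_zero]
  have hub : ∀ᶠ t in atTop, t ∈ T → volume {x | x ∈ Set.Icc a b ∧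
      ∀ y ∈ rationalsNearGraph f (2 ^ t) (δ t), ρ t < |x - y|} ≤
      ENNReal.ofReal ((b - a) / 2) := by
    filter_upwards [hlarge (20000 * M), hlarge' 2 c hc, hlarge' 1 (a - A) (by linarith),
      hlarge' 1 (B - b) (by linarith),
      hlarge' (804 + (60 * M / √c + 8) / 2 * (b - a + 2) + 8 * (b - a + 4)) ((b - a) / 8)
        (by linarith), hρ (a - A) (by linarith), hρ (B - b) (by linarith)]
      with t t1 t2 t3 t4 t5 t6 t7 htT
    refine le_trans (measure_mono ?_) (hf.volume_nearRational_denom_le_half (X := ξ ^ t)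
      (δ := δ t) hab.le t1 (by linarith) t3 t4 t5 (hδX t) htT)
    rintro x ⟨hx, hxy⟩
    refine ⟨hx, ?_⟩
    by_contra hcon
    have e1 : (((2 ^ t : ℕ) : ℝ)) = 2 ^ t := by push_cast; rfl
    rw [← h2, ← e1] at hcon
    obtain ⟨y, hy, hxy'⟩ := hf.exists_rationalsNearGraph (hδ0 t) (hδ1 t)
      (by
        rw [e1, h2]
        calc 1 ≤ (ξ ^ t) ^ 49 * (δ t * (ξ ^ t) ^ 51) :=
            one_le_mul_of_one_le_of_one_le (one_le_pow₀ (hX1 t)) htT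
          _ = _ := by ring)
      (by
        rw [e1, h2]
        calc 4 * M ≤ (ξ ^ t) ^ 1 := by linarith
          _ ≤ (ξ ^ t) ^ 47 := pow_le_pow_right₀ (hX1 t) (by norm_num)
          _ ≤ (ξ ^ t) ^ 47 * (δ t * (ξ ^ t) ^ 51) ^ 3 :=
            le_mul_of_one_le_right (by positivity) (one_le_pow₀ htT)
          _ = _ := by ring)
      (by rw [e1]; linarith [t6 htT, hx.1]) (by rw [e1]; linarith [t7 htT, hx.2]) hcon
    rw [e1] at hy hxy'
    exact absurd hxy' (not_le.2 (hxy y hy))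
  refine le_trans (measure_mono ?_) (volume_diff_limsup_le hab T
    (fun t => rationalsNearGraph f (2 ^ t) (δ t)) ρ r hr0 hr
    (fun t _ => div_pos (by norm_num) (mul_pos (by positivity) (hδ0 t))) hρ hub hdiv')
  rintro x ⟨hx, hxS⟩
  refine ⟨hx, fun hfreq => hxS ?_⟩
  rw [Set.mem_ofPred_eq] at hfreq
  have hrt := tendsto_zero_of_succ_le_half hr0 hr
  refine Set.infinite_of_forall_exists_gt fun n => ?_
  obtain ⟨t, ⟨htT, y, hy, hxy⟩, t1, t2, t3⟩ := (hfreq.and_eventually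
    ((hrt.eventually_le_const (show 0 < a - A by linarith)).and
      ((hrt.eventually_le_const (show 0 < B - b by linarith)).and
        ((tendsto_pow_atTop_atTop_of_one_lt (one_lt_two : (1 : ℝ) < 2)).eventually_ge_atTop
          (10000 * n))))).exists
  have hyAB : y ∈ Set.Icc A B := by
    rw [abs_le] at hxy
    constructor <;> linarith [hx.1, hx.2]
  obtain ⟨q, hq0, hq1, hq2, hq⟩ := hf.approx_of_near_rationalsNearGraph (Q := 2 ^ t)
    (by positivity) ⟨by linarith [hx.1], by linarith [hx.2]⟩ hyAB hy hxy
  refine ⟨q, ⟨hq0, hq.trans_lt ((hδψ t).trans_le (hψ.1 _ _ (by exact_mod_cast hq0) hq2))⟩, ?_⟩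
  have : (n : ℝ) < q := by linarith
  exact_mod_cast this

theorem volume_diff_simApprox2_eq_zero (hf : ConvexArc f f₁ A B c M) {ψ : ℝ → ℝ}
    (hψ : IsApproxFun ψ) (hdiv : ¬ Summable (fun h : ℕ => ψ h ^ 2)) :
    volume (Set.Ioo A B \ {x | (x, f x) ∈ SimApprox2 ψ}) = 0 := by
  set E := Set.Ioo A B \ {x | (x, f x) ∈ SimApprox2 ψ} with hE
  have hnot : ∀ x ∈ E, ¬ Tendsto (fun r => volume (E ∩ Metric.closedBall x r) /
      volume (Metric.closedBall x r)) (nhdsWithin 0 (Set.Ioi 0)) (nhds 1) := by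
    intro x hx hlim
    have hx1 : 0 < min (x - A) (B - x) := lt_min (by linarith [hx.1.1]) (by linarith [hx.1.2])
    have h1 : ∀ᶠ r in nhdsWithin 0 (Set.Ioi (0 : ℝ)), volume (E ∩ Metric.closedBall x r) /
        volume (Metric.closedBall x r) ≤ ENNReal.ofReal (111 / 112) := by
      filter_upwards [self_mem_nhdsWithin, mem_nhdsWithin_of_mem_nhds (Iio_mem_nhds hx1)]
        with r hr0 hr1
      rw [Set.mem_Ioi] at hr0
      rw [Set.mem_Iio, lt_min_iff] at hr1
      apply ENNReal.div_le_of_le_mul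
      rw [Real.volume_closedBall, ← ENNReal.ofReal_mul (by norm_num)]
      refine le_trans (measure_mono ?_) ((hf.volume_diff_simApprox2_le hψ hdiv (a := x - r)
        (b := x + r) (by linarith) (by linarith) (by linarith)).trans_eq (by congr 1; ring))
      rintro y ⟨hyE, hyr⟩
      rw [Real.closedBall_eq_Icc] at hyr
      exact ⟨hyr, hyE.2⟩
    have h2 := le_of_tendsto hlim h1
    rw [← ENNReal.ofReal_one, ENNReal.ofReal_le_ofReal_iff (by norm_num)] at h2
    norm_num at h2
  have hae := Besicovitch.ae_tendsto_measure_inter_div (volume : Measure ℝ) E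
  have hall : ∀ᵐ x ∂(volume.restrict E), x ∉ E := by
    filter_upwards [hae] with x hx hxE using hnot x hxE hx
  have h3 := ae_iff.1 hall
  simp only [not_not] at h3
  have h4 : volume.restrict E E = 0 := h3
  rwa [Measure.restrict_apply_self] at h4

end ConvexArc

theorem distNearestInt_neg (x : ℝ) : distNearestInt (-x) = distNearestInt x := by
  have key : ∀ y : ℝ, distNearestInt (-y) ≤ distNearestInt y := fun y => by
    refine (distNearestInt_le (-y) (-round y)).trans_eq ?_
    rw [distNearestInt, ← abs_neg]
    congr 1
    push_cast
    ring
  exact le_antisymm (key x) (by simpa using key (-x))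

theorem mem_simApprox2_neg_snd {ψ : ℝ → ℝ} {x y : ℝ} :
    (x, -y) ∈ SimApprox2 ψ ↔ (x, y) ∈ SimApprox2 ψ := by
  simp only [SimApprox2, Set.mem_ofPred_eq, mul_neg, distNearestInt_neg]

theorem exists_convexArc_of_deriv2_pos {f : ℝ → ℝ} {U : Set ℝ} (hU : IsOpen U)
    (hf : ContDiffOn ℝ 2 f U) {x : ℝ} (hx : x ∈ U) (hpos : 0 < deriv (deriv f) x) :
    ∃ A B c M : ℝ, x ∈ Set.Ioo A B ∧ ConvexArc f (deriv f) A B c M := by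
  have h1 : ContDiffOn ℝ 1 (deriv f) U := hf.deriv_of_isOpen hU (by norm_num)
  have h2 : ContinuousOn (deriv (deriv f)) U := h1.continuousOn_deriv_of_isOpen hU le_rfl
  set D := deriv (deriv f) x with hD
  have e2 := (h2.continuousAt (hU.mem_nhds hx)).eventually
    (Ioo_mem_nhds (show D / 2 < deriv (deriv f) x by linarith)
      (show deriv (deriv f) x < 2 * D by linarith))
  have e1 := (h1.continuousOn.continuousAt (hU.mem_nhds hx)).abs.eventually
    (Iio_mem_nhds (show |deriv f x| < |deriv f x| + 1 by linarith))
  obtain ⟨ε, hε, hball⟩ := Metric.eventually_nhds_iff_ball.1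
    ((hU.eventually_mem hx).and (e2.and e1))
  have hmem : ∀ y ∈ Set.Icc (x - ε / 2) (x + ε / 2), y ∈ Metric.ball x ε := fun y hy => by
    rw [Metric.mem_ball, Real.dist_eq, abs_lt]
    constructor <;> linarith [hy.1, hy.2]
  have hd1 : ∀ y ∈ Set.Icc (x - ε / 2) (x + ε / 2), DifferentiableAt ℝ (deriv f) y := fun y hy =>
    (h1.differentiableOn (by norm_num)).differentiableAt (hU.mem_nhds (hball y (hmem y hy)).1)
  have hcont : ContinuousOn (deriv f) (Set.Icc (x - ε / 2) (x + ε / 2)) := fun y hy =>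
    (hd1 y hy).continuousAt.continuousWithinAt
  have hdiff : DifferentiableOn ℝ (deriv f) (interior (Set.Icc (x - ε / 2) (x + ε / 2))) :=
    fun y hy => (hd1 y (interior_subset hy)).differentiableWithinAt
  refine ⟨x - ε / 2, x + ε / 2, D / 2, max 1 (max (2 * D) (|deriv f x| + 1)),
    ⟨by linarith, by linarith⟩, by positivity, le_max_left _ _, fun y hy => ?_,
    fun y hy z hz hyz => ?_, fun y hy z hz hyz => ?_, fun y hy => ?_⟩
  · exact ((hf.differentiableOn (by norm_num)).differentiableAt
      (hU.mem_nhds (hball y (hmem y hy)).1)).hasDerivAt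
  · exact (convex_Icc _ _).mul_sub_le_image_sub_of_le_deriv hcont hdiff
      (fun w hw => (hball w (hmem w (interior_subset hw))).2.1.1.le) y hy z hz hyz
  · exact (convex_Icc _ _).image_sub_le_mul_sub_of_deriv_le hcont hdiff
      (fun w hw => (hball w (hmem w (interior_subset hw))).2.1.2.le.trans
        ((le_max_left _ _).trans (le_max_right _ _))) y hy z hz hyz
  · exact (le_of_lt (hball y (hmem y hy)).2.2).trans ((le_max_right _ _).trans (le_max_right _ _))

theorem exists_nhds_volume_diff_simApprox2_eq_zero {f : ℝ → ℝ} {U : Set ℝ} (hU : IsOpen U)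
    (hf : ContDiffOn ℝ 2 f U) {x : ℝ} (hx : x ∈ U) (hne : deriv (deriv f) x ≠ 0) {ψ : ℝ → ℝ}
    (hψ : IsApproxFun ψ) (hdiv : ¬ Summable (fun h : ℕ => ψ h ^ 2)) :
    ∃ V ∈ nhds x, volume (V \ {y | (y, f y) ∈ SimApprox2 ψ}) = 0 := by
  rcases hne.lt_or_gt with h | h
  · have hneg : 0 < deriv (deriv (-f)) x := by
      rw [deriv.neg', deriv.fun_neg]
      linarith
    obtain ⟨A, B, c, M, hxAB, harc⟩ := exists_convexArc_of_deriv2_pos hU hf.neg hx hneg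
    refine ⟨Set.Ioo A B, Ioo_mem_nhds hxAB.1 hxAB.2, ?_⟩
    have := harc.volume_diff_simApprox2_eq_zero hψ hdiv
    simpa only [Pi.neg_apply, mem_simApprox2_neg_snd] using this
  · obtain ⟨A, B, c, M, hxAB, harc⟩ := exists_convexArc_of_deriv2_pos hU hf hx h
    exact ⟨Set.Ioo A B, Ioo_mem_nhds hxAB.1 hxAB.2, harc.volume_diff_simApprox2_eq_zero hψ hdiv⟩

theorem iteratedDerivWithin_two_eq_of_mem_interior {f : ℝ → ℝ} {s : Set ℝ} {x : ℝ}
    (hx : x ∈ interior s) : iteratedDerivWithin 2 f s x = deriv (deriv f) x := by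
  have h1 : ∀ y ∈ interior s, iteratedDerivWithin 1 f s y = deriv f y := fun y hy => by
    rw [iteratedDerivWithin_one,
      derivWithin_of_mem_nhds (mem_interior_iff_mem_nhds.1 hy)]
  rw [iteratedDerivWithin_succ, derivWithin_of_mem_nhds (mem_interior_iff_mem_nhds.1 hx)]
  exact Filter.EventuallyEq.deriv_eq (eventually_of_mem (isOpen_interior.mem_nhds hx) h1)

theorem volume_diff_eq_zero_of_deriv2_ne_zero {I : Set ℝ} (hI : I.OrdConnected) {f : ℝ → ℝ}
    (hf : ContDiffOn ℝ 3 f I)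
    (hf'' : ∀ᵐ x ∂(volume.restrict I), iteratedDerivWithin 2 f I x ≠ 0)
    {ψ : ℝ → ℝ} (hψ : IsApproxFun ψ) (hdiv : ¬ Summable (fun h : ℕ => ψ h ^ 2)) :
    volume (I \ {x | (x, f x) ∈ SimApprox2 ψ}) = 0 := by
  set S := {x | (x, f x) ∈ SimApprox2 ψ}
  have h0 : volume (frontier I) = 0 := hI.convex.addHaar_frontier volume
  have h1 : volume {x | ¬ (x ∈ I → iteratedDerivWithin 2 f I x ≠ 0)} = 0 :=
    ae_iff.1 ((ae_restrict_iff' hI.measurableSet).1 hf'')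
  have h2 : volume ({x ∈ interior I | deriv (deriv f) x ≠ 0} \ S) = 0 := by
    refine measure_null_of_locally_null _ fun x hx => ?_
    obtain ⟨V, hV, hV0⟩ := exists_nhds_volume_diff_simApprox2_eq_zero isOpen_interior
      ((hf.mono interior_subset).of_le (by norm_num)) hx.1.1 hx.1.2 hψ hdiv
    exact ⟨_, inter_mem_nhdsWithin _ hV,
      measure_mono_null (t := V \ S) (fun y hy => ⟨hy.2, hy.1.2⟩) hV0⟩
  refine measure_mono_null ?_ (measure_union_null h0 (measure_union_null h1 h2))
  rintro x ⟨hxI, hxS⟩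
  by_cases hxi : x ∈ interior I
  · refine Or.inr ?_
    by_cases hx0 : deriv (deriv f) x = 0
    · refine Or.inl ?_
      rw [Set.mem_ofPred_eq, iteratedDerivWithin_two_eq_of_mem_interior hxi]
      exact fun h => h hxI hx0
    · exact Or.inr ⟨⟨hxi, hx0⟩, hxS⟩
  · exact Or.inl ⟨subset_closure hxI, hxi⟩

theorem hausdorffMeasure_graph_image_eq_zero {I Z : Set ℝ} (hI : I.OrdConnected) {f : ℝ → ℝ}
    (hf : ContDiffOn ℝ 1 f I) (hZ : Z ⊆ I) (hZ0 : volume Z = 0) :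
    μH[1] ((fun x => (x, f x)) '' Z) = 0 := by
  have hloc : ∀ x ∈ Z, ∃ t ∈ nhdsWithin x Z, μH[1] ((fun x => (x, f x)) '' (Z ∩ t)) = 0 := by
    intro x hx
    obtain ⟨K, t, ht, hK⟩ := (hf x (hZ hx)).exists_lipschitzOnWith hI.convex
    refine ⟨t, nhdsWithin_mono x hZ ht, le_antisymm ?_ zero_le⟩
    refine (((LipschitzWith.id.lipschitzOnWith).prodMk
      (hK.mono Set.inter_subset_right)).hausdorffMeasure_image_le zero_le_one).trans ?_
    rw [hausdorffMeasure_real, measure_mono_null Set.inter_subset_left hZ0, mul_zero]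
  choose! t ht ht0 using hloc
  obtain ⟨T, hTZ, hTc, hT⟩ := TopologicalSpace.countable_cover_nhdsWithin ht
  refine measure_mono_null ?_ ((measure_biUnion_null_iff hTc).2 fun x hx => ht0 x (hTZ hx))
  rintro _ ⟨x, hx, rfl⟩
  obtain ⟨i, hi, hxi⟩ := Set.mem_iUnion₂.1 (hT hx)
  exact Set.mem_iUnion₂.2 ⟨i, hi, x, ⟨hx, hxi⟩, rfl⟩

theorem curve_khintchine_type_for_divergence
    (I₀ : Set ℝ) (hI₀ : I₀.OrdConnected)
    (f : ℝ → ℝ) (hf : ContDiffOn ℝ 3 f I₀)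
    (hf'' : ∀ᵐ x ∂(volume.restrict I₀), iteratedDerivWithin 2 f I₀ x ≠ 0)
    (ψ : ℝ → ℝ) (hψ : IsApproxFun ψ)
    (hdiv : ¬ Summable (fun h : ℕ => ψ h ^ 2)) :
    μH[1] (((fun x => (x, f x)) '' I₀) \ SimApprox2 ψ) = 0 := by
  refine measure_mono_null ?_ (hausdorffMeasure_graph_image_eq_zero hI₀ (hf.of_le (by norm_num))
    Set.sdiff_subset (volume_diff_eq_zero_of_deriv2_ne_zero hI₀ hf hf'' hψ hdiv))
  rintro _ ⟨⟨x, hx, rfl⟩, hxS⟩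
  exact ⟨x, ⟨hx, hxS⟩, rfl⟩
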